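/- arXiv:1409.7940 — 6 statements merged into one kernel-verified Lean document; each statement's English description precedes it below -/
import Mathlib

section
/- Weak law of large numbers for uncorrelated arrays: Let (Z^n_k), n ∈ ℕ, 1 ≤ k ≤ n, be a triangular array of nonnegative integrable random variables on a probability space (Ω, F, P) such that the whole family (Z^n_k)_{n ∈ ℕ, 1 ≤ k ≤ n} is uniformly integrable and, for every n, the variables Z^n_1, …, Z^n_n are pairwise uncorrelated, i.e. E[Z^n_k Z^n_l] = E[Z^n_k]·E[Z^n_l] for all 1 ≤ k < l ≤ n. Then (1/n)·∑_{k=1}^n (Z^n_k − E[Z^n_k]) converges to 0 in probability as n → ∞. -/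
open MeasureTheory Filter Set Topology
open scoped ENNReal

/-- Truncating a nonnegative random variable at level `M` costs at most its tail expectation. -/
lemma integral_sub_integral_min_le {Ω : Type*} [MeasurableSpace Ω] {P : Measure Ω}
    [IsProbabilityMeasure P] {X : Ω → ℝ} (hX : Measurable X) (hX0 : ∀ ω, 0 ≤ X ω)
    (hXi : Integrable X P) {M : ℝ} (hM : 0 ≤ M) :
    (∫ ω, X ω ∂P) - ∫ ω, min (X ω) M ∂P ≤ ∫ ω in {ω | M < |X ω|}, |X ω| ∂P := by
  have hmin : Integrable (fun ω => min (X ω) M) P := hXi.inf (integrable_const M)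
  have hs : MeasurableSet {ω | M < |X ω|} := measurableSet_lt measurable_const hX.abs
  rw [← integral_sub hXi hmin, ← integral_indicator hs]
  refine integral_mono (hXi.sub hmin) (hXi.abs.indicator hs) fun ω => ?_
  by_cases h : M < |X ω|
  · rw [indicator_of_mem (by exact h)]
    have := le_min (hX0 ω) hM
    have := le_abs_self (X ω)
    dsimp only
    linarith
  · rw [indicator_of_notMem (by exact h)]
    have := (le_abs_self (X ω)).trans (not_lt.1 h)
    simp [min_eq_left this]

/-- For nonnegative random variables with nonpositive pairwise covariances, a bound on the second
moment of the sum of the truncations around the mean of the untruncated sum. -/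
lemma integral_sq_sum_min_sub_le {Ω ι : Type*} [MeasurableSpace Ω] {P : Measure Ω}
    [IsProbabilityMeasure P] (s : Finset ι) {X : ι → Ω → ℝ} (hX0 : ∀ k ω, 0 ≤ X k ω)
    (hXi : ∀ k ∈ s, Integrable (X k) P)
    (hprod : ∀ k ∈ s, ∀ l ∈ s, k ≠ l → Integrable (fun ω => X k ω * X l ω) P)
    (hcov : ∀ k ∈ s, ∀ l ∈ s, k ≠ l →
      ∫ ω, X k ω * X l ω ∂P ≤ (∫ ω, X k ω ∂P) * ∫ ω, X l ω ∂P)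
    {M : ℝ} (hM : 0 ≤ M) :
    Integrable (fun ω => (∑ k ∈ s, min (X k ω) M - ∑ k ∈ s, ∫ ω', X k ω' ∂P) ^ 2) P ∧
    ∫ ω, (∑ k ∈ s, min (X k ω) M - ∑ k ∈ s, ∫ ω', X k ω' ∂P) ^ 2 ∂P ≤
      s.card * M ^ 2 + 2 * (∑ k ∈ s, ∫ ω, X k ω ∂P) *
        ∑ k ∈ s, ((∫ ω, X k ω ∂P) - ∫ ω, min (X k ω) M ∂P) := by
  classical
  set a := ∑ k ∈ s, ∫ ω', X k ω' ∂P with ha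
  have hY0 (k : ι) (ω : Ω) : 0 ≤ min (X k ω) M := le_min (hX0 k ω) hM
  have hYi (k) (hk : k ∈ s) : Integrable (fun ω => min (X k ω) M) P :=
    (hXi k hk).inf (integrable_const M)
  have hYY (k) (hk : k ∈ s) (l) (hl : l ∈ s) :
      Integrable (fun ω => min (X k ω) M * min (X l ω) M) P := by
    refine (hYi k hk).mul_bdd (c := M) (hYi l hl).aestronglyMeasurable (.of_forall fun ω => ?_)
    rw [Real.norm_of_nonneg (hY0 l ω)]
    exact min_le_right _ _
  have hle (k) (hk : k ∈ s) (l) (hl : l ∈ s) : ∫ ω, min (X k ω) M * min (X l ω) M ∂P ≤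
      (∫ ω, X k ω ∂P) * (∫ ω, X l ω ∂P) + if k = l then M ^ 2 else 0 := by
    split_ifs with h
    · subst h
      have h1 : ∫ ω, min (X k ω) M * min (X k ω) M ∂P ≤ ∫ _, M ^ 2 ∂P :=
        integral_mono (hYY k hk k hk) (integrable_const _) fun ω => by
          have := hY0 k ω
          have := min_le_right (X k ω) M
          dsimp only
          nlinarith
      rw [integral_const, probReal_univ, one_smul] at h1
      linarith [mul_self_nonneg (∫ ω, X k ω ∂P)]
    · rw [add_zero]
      refine le_trans (integral_mono (hYY k hk l hl) (hprod k hk l hl h) fun ω => ?_)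
        (hcov k hk l hl h)
      exact mul_le_mul (min_le_left _ _) (min_le_left _ _) (hY0 l ω) (hX0 k ω)
  have hexpand : (fun ω => (∑ k ∈ s, min (X k ω) M - a) ^ 2) = fun ω =>
      ∑ k ∈ s, ∑ l ∈ s, min (X k ω) M * min (X l ω) M -
        2 * a * ∑ k ∈ s, min (X k ω) M + a ^ 2 := by
    funext ω
    rw [← Finset.sum_mul_sum]
    ring
  have hi1 : Integrable (fun ω => ∑ k ∈ s, ∑ l ∈ s, min (X k ω) M * min (X l ω) M) P :=
    integrable_finsetSum _ fun k hk => integrable_finsetSum _ fun l hl => hYY k hk l hl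
  have hi2 : Integrable (fun ω => 2 * a * ∑ k ∈ s, min (X k ω) M) P :=
    (integrable_finsetSum _ hYi).const_mul _
  have hi12 : Integrable (fun ω => ∑ k ∈ s, ∑ l ∈ s, min (X k ω) M * min (X l ω) M -
      2 * a * ∑ k ∈ s, min (X k ω) M) P := hi1.sub hi2
  rw [hexpand]
  refine ⟨hi12.add (integrable_const _), ?_⟩
  have hint : ∫ ω, (∑ k ∈ s, ∑ l ∈ s, min (X k ω) M * min (X l ω) M -
        2 * a * ∑ k ∈ s, min (X k ω) M + a ^ 2) ∂P =
      ∑ k ∈ s, ∑ l ∈ s, ∫ ω, min (X k ω) M * min (X l ω) M ∂P -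
        2 * a * ∑ k ∈ s, ∫ ω, min (X k ω) M ∂P + a ^ 2 := by
    rw [integral_add hi12 (integrable_const _), integral_sub hi1 hi2,
      integral_const_mul, integral_finsetSum _ hYi, integral_const, probReal_univ, one_smul,
      integral_finsetSum _ fun k hk => integrable_finsetSum _ fun l hl => hYY k hk l hl,
      Finset.sum_congr rfl fun k hk => integral_finsetSum _ fun l hl => hYY k hk l hl]
  have hsum : ∑ k ∈ s, ∑ l ∈ s, ∫ ω, min (X k ω) M * min (X l ω) M ∂P ≤
      a * a + s.card * M ^ 2 := by
    refine (Finset.sum_le_sum fun k hk => Finset.sum_le_sum fun l hl => hle k hk l hl).trans_eq ?_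
    simp only [Finset.sum_add_distrib, ← Finset.sum_mul_sum, Finset.sum_ite_eq]
    simp [ha]
  rw [hint, Finset.sum_sub_distrib, ← ha]
  linarith

/-- Markov's inequality for the deviation of `c * (S - a)`, where `S` is split as a sum `T` plus
a nonnegative integrable remainder. -/
lemma measureReal_lt_abs_mul_sub_le {Ω : Type*} [MeasurableSpace Ω] {P : Measure Ω}
    [IsFiniteMeasure P] {S T : Ω → ℝ} (a c : ℝ) (hc : 0 ≤ c) (hTS : ∀ ω, T ω ≤ S ω)
    (hT : Integrable (fun ω => (T ω - a) ^ 2) P) (hST : Integrable (fun ω => S ω - T ω) P)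
    {ε : ℝ} (hε : 0 < ε) :
    P.real {ω | ε < |c * (S ω - a)|} ≤
      4 / ε ^ 2 * c ^ 2 * ∫ ω, (T ω - a) ^ 2 ∂P + 2 / ε * c * ∫ ω, (S ω - T ω) ∂P := by
  set f : Ω → ℝ := fun ω => 4 / ε ^ 2 * c ^ 2 * (T ω - a) ^ 2 + 2 / ε * c * (S ω - T ω) with hf
  have hD0 (ω : Ω) : 0 ≤ S ω - T ω := sub_nonneg.2 (hTS ω)
  have hf0 (ω : Ω) : 0 ≤ f ω := by
    have := hD0 ω
    positivity
  have hfi : Integrable f P := (hT.const_mul _).add (hST.const_mul _)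
  have hmarkov := mul_meas_ge_le_integral_of_nonneg (.of_forall hf0) hfi 1
  rw [one_mul, hf, integral_add (hT.const_mul _) (hST.const_mul _), integral_const_mul,
    integral_const_mul] at hmarkov
  refine (measureReal_mono fun ω hω => ?_).trans hmarkov
  have hω : ε < |c * (S ω - a)| := hω
  change 1 ≤ 4 / ε ^ 2 * c ^ 2 * (T ω - a) ^ 2 + 2 / ε * c * (S ω - T ω)
  have hD : 0 ≤ c * (S ω - T ω) := mul_nonneg hc (hD0 ω)
  have htri : |c * (S ω - a)| ≤ |c * (T ω - a)| + c * (S ω - T ω) := by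
    calc |c * (S ω - a)| = |c * (T ω - a) + c * (S ω - T ω)| := by ring_nf
      _ ≤ _ := (abs_add_le _ _).trans_eq (by rw [abs_of_nonneg hD])
  have e1 : 4 / ε ^ 2 * c ^ 2 * (T ω - a) ^ 2 = (2 * |c * (T ω - a)| / ε) ^ 2 := by
    rw [div_pow, mul_pow, sq_abs]
    ring
  have e2 : 2 / ε * c * (S ω - T ω) = 2 * (c * (S ω - T ω)) / ε := by ring
  rw [e1, e2]
  rcases le_total (ε / 2) (c * (S ω - T ω)) with h | h
  · have : 1 ≤ 2 * (c * (S ω - T ω)) / ε := by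
      rw [le_div_iff₀ hε]
      linarith
    linarith [sq_nonneg (2 * |c * (T ω - a)| / ε)]
  · have h1 : 1 ≤ 2 * |c * (T ω - a)| / ε := by
      rw [le_div_iff₀ hε]
      linarith
    have h2 : 0 ≤ 2 * (c * (S ω - T ω)) / ε := by positivity
    linarith [one_le_pow₀ h1 (n := 2)]

/-- **Weak law of large numbers for uncorrelated arrays.**
Let `(Z n k)`, `n ∈ ℕ`, `1 ≤ k ≤ n`, be a triangular array of nonnegative integrable random
variables on a probability space `(Ω, P)` such that the whole family is uniformly integrable
and, for every `n`, the variables `Z n 1, …, Z n n` are pairwise uncorrelated.  Then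
`(1/n) ∑_{k=1}^n (Z n k − E[Z n k])` converges to `0` in probability as `n → ∞`. -/
theorem wlln_uncorrelated_arrays
    {Ω : Type*} [MeasurableSpace Ω] (P : Measure Ω) [IsProbabilityMeasure P]
    (Z : ℕ → ℕ → Ω → ℝ)
    (hmeas : ∀ n k, Measurable (Z n k))
    (hnonneg : ∀ n k ω, 0 ≤ Z n k ω)
    (hint : ∀ n k, 1 ≤ k → k ≤ n → Integrable (Z n k) P)
    -- uniform integrability: `sup_{n, 1 ≤ k ≤ n} E[|Z n k| 1_{|Z n k| > y}] → 0` as `y → ∞`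
    (hUI : ∀ ε > (0 : ℝ), ∃ y₀ : ℝ, ∀ y ≥ y₀, ∀ (n k : ℕ), 1 ≤ k → k ≤ n →
      ∫ ω in {ω | y < |Z n k ω|}, |Z n k ω| ∂P ≤ ε)
    -- pairwise uncorrelated: `E[Z n k · Z n l] = E[Z n k] · E[Z n l]` for `1 ≤ k < l ≤ n`
    (huncorr : ∀ n k l, 1 ≤ k → k < l → l ≤ n →
      Integrable (fun ω => Z n k ω * Z n l ω) P ∧
      ∫ ω, Z n k ω * Z n l ω ∂P = (∫ ω, Z n k ω ∂P) * (∫ ω, Z n l ω ∂P)) :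
    ∀ ε > (0 : ℝ),
      Tendsto
        (fun n : ℕ =>
          P {ω | ε < |(n : ℝ)⁻¹ * ∑ k ∈ Finset.Icc 1 n, (Z n k ω - ∫ ω', Z n k ω' ∂P)|})
        atTop (𝓝 0) := by
  intro ε hε
  have htrunc {n k : ℕ} (hk : k ∈ Finset.Icc 1 n) {M : ℝ} (hM : 0 ≤ M) :=
    integral_sub_integral_min_le (hmeas n k) (hnonneg n k)
      (hint n k (Finset.mem_Icc.1 hk).1 (Finset.mem_Icc.1 hk).2) hM
  obtain ⟨C, hC, hZC⟩ : ∃ C > (0 : ℝ), ∀ n, ∀ k ∈ Finset.Icc 1 n, ∫ ω, Z n k ω ∂P ≤ C := by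
    obtain ⟨y, hy⟩ := hUI 1 one_pos
    refine ⟨max y 0 + 1, by positivity, fun n k hk => ?_⟩
    have hk' := Finset.mem_Icc.1 hk
    have h1 := hy (max y 0) (le_max_left _ _) n k hk'.1 hk'.2
    have h2 := htrunc hk (le_max_right y 0)
    have h3 : ∫ ω, min (Z n k ω) (max y 0) ∂P ≤ ∫ _, max y 0 ∂P :=
      integral_mono ((hint n k hk'.1 hk'.2).inf (integrable_const _)) (integrable_const _)
        fun ω => min_le_right _ _
    rw [integral_const, probReal_univ, one_smul] at h3
    linarith
  have key {δ : ℝ} (hδ : 0 < δ) : ∃ M : ℝ, ∀ n : ℕ, 0 < n →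
      P.real {ω | ε < |(n : ℝ)⁻¹ * ∑ k ∈ Finset.Icc 1 n, (Z n k ω - ∫ ω', Z n k ω' ∂P)|} ≤
        4 / ε ^ 2 * M ^ 2 / n + (8 / ε ^ 2 * C + 2 / ε) * δ := by
    obtain ⟨y, hy⟩ := hUI δ hδ
    refine ⟨max y 0, fun n hn => ?_⟩
    set M := max y 0
    have hM : 0 ≤ M := le_max_right _ _
    have hn' : (0 : ℝ) < n := Nat.cast_pos.2 hn
    have hi (k) (hk : k ∈ Finset.Icc 1 n) : Integrable (Z n k) P :=
      hint n k (Finset.mem_Icc.1 hk).1 (Finset.mem_Icc.1 hk).2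
    have hmin (k) (hk : k ∈ Finset.Icc 1 n) : Integrable (fun ω => min (Z n k ω) M) P :=
      (hi k hk).inf (integrable_const M)
    have hpair (k) (hk : k ∈ Finset.Icc 1 n) (l) (hl : l ∈ Finset.Icc 1 n) (hkl : k ≠ l) :
        Integrable (fun ω => Z n k ω * Z n l ω) P ∧
        ∫ ω, Z n k ω * Z n l ω ∂P = (∫ ω, Z n k ω ∂P) * (∫ ω, Z n l ω ∂P) := by
      rw [Finset.mem_Icc] at hk hl
      rcases hkl.lt_or_gt with h | h
      · exact huncorr n k l hk.1 h hl.2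
      · simpa only [mul_comm] using huncorr n l k hl.1 h hk.2
    obtain ⟨hsq, hsq_le⟩ := integral_sq_sum_min_sub_le (Finset.Icc 1 n) (hnonneg n) hi
      (fun k hk l hl h => (hpair k hk l hl h).1) (fun k hk l hl h => (hpair k hk l hl h).2.le) hM
    have hdiff : Integrable
        (fun ω => ∑ k ∈ Finset.Icc 1 n, Z n k ω - ∑ k ∈ Finset.Icc 1 n, min (Z n k ω) M) P :=
      (integrable_finsetSum _ hi).sub (integrable_finsetSum _ hmin)
    have hmarkov := measureReal_lt_abs_mul_sub_le (∑ k ∈ Finset.Icc 1 n, ∫ ω, Z n k ω ∂P)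
      (n : ℝ)⁻¹ (by positivity) (fun ω => Finset.sum_le_sum fun k _ => min_le_left _ _)
      hsq hdiff hε
    rw [integral_sub (integrable_finsetSum _ hi) (integrable_finsetSum _ hmin),
      integral_finsetSum _ hi, integral_finsetSum _ hmin, ← Finset.sum_sub_distrib] at hmarkov
    have hdefect : ∑ k ∈ Finset.Icc 1 n, ((∫ ω, Z n k ω ∂P) - ∫ ω, min (Z n k ω) M ∂P) ≤
        n * δ := by
      refine (Finset.sum_le_card_nsmul _ _ δ fun k hk => (htrunc hk hM).trans
        (hy M (le_max_left _ _) n k (Finset.mem_Icc.1 hk).1 (Finset.mem_Icc.1 hk).2)).trans_eq ?_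
      simp
    have hmean : ∑ k ∈ Finset.Icc 1 n, ∫ ω, Z n k ω ∂P ≤ n * C :=
      (Finset.sum_le_card_nsmul _ _ C (hZC n)).trans_eq (by simp)
    have hmean0 : 0 ≤ ∑ k ∈ Finset.Icc 1 n, ∫ ω, Z n k ω ∂P :=
      Finset.sum_nonneg fun k _ => integral_nonneg (hnonneg n k)
    have hsq_le' := calc
      _ ≤ _ := hsq_le
      _ ≤ n * M ^ 2 + 2 * (n * C) * (n * δ) := by
        rw [Nat.card_Icc, Nat.add_sub_cancel]
        exact add_le_add_right (mul_le_mul_of_nonneg (by gcongr) hdefect (by positivity)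
          (by positivity)) _
    simp only [Finset.sum_sub_distrib] at hmarkov hdefect ⊢
    refine hmarkov.trans ?_
    calc _ ≤ 4 / ε ^ 2 * (n : ℝ)⁻¹ ^ 2 * (n * M ^ 2 + 2 * (n * C) * (n * δ)) +
          2 / ε * (n : ℝ)⁻¹ * (n * δ) := by gcongr
      _ = _ := by
        field_simp
        ring
  rw [← ENNReal.tendsto_toReal_iff (fun n => measure_ne_top _ _) ENNReal.zero_ne_top,
    ENNReal.toReal_zero]
  refine Metric.tendsto_atTop'.2 fun η hη => ?_
  obtain ⟨δ, hδ, hδη⟩ : ∃ δ > (0 : ℝ), (8 / ε ^ 2 * C + 2 / ε) * δ = η / 2 :=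
    ⟨η / 2 / (8 / ε ^ 2 * C + 2 / ε), by positivity, by field_simp⟩
  obtain ⟨M, hM⟩ := key hδ
  obtain ⟨N, hN⟩ := eventually_atTop.1 ((tendsto_const_div_atTop_nhds_zero_nat
    (4 / ε ^ 2 * M ^ 2)).eventually_lt_const (half_pos hη))
  refine ⟨N, fun n hn => ?_⟩
  have h1 := hN n hn.le
  have h2 := hM n (Nat.zero_lt_of_lt hn)
  rw [Real.dist_0_eq_abs, abs_of_nonneg ENNReal.toReal_nonneg]
  rw [measureReal_def] at h2
  linarith
end

section
/- Suppose l = −∞ and r = ∞ (so I = ℝ). If there exists ȳ ∈ ℝ such that G_ȳ(a) < ∞ for all a > 0, then for all y ∈ ℝ and all a > 0 one has G_y(a) < ∞. -/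
open MeasureTheory Filter Set Topology
open scoped ENNReal

/-- The integrand `2/η(z)²`, valued in `[0,∞]` (it equals `∞` where `η` vanishes). -/
noncomputable def qIntegrand (η : ℝ → ℝ) (z : ℝ) : ℝ≥0∞ :=
  2 / ENNReal.ofReal ((η z) ^ 2)

/-- `q(y,x) = ∫_y^x ∫_y^u 2/η(z)² dz du ∈ [0,∞]`, the oriented iterated integral (nonnegative
also for `x < y`, since both orientations flip). -/
noncomputable def qfun (η : ℝ → ℝ) (y x : ℝ) : ℝ≥0∞ :=
  if y ≤ x then ∫⁻ u in Set.Ioc y x, ∫⁻ z in Set.Ioc y u, qIntegrand η z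
  else ∫⁻ u in Set.Ioc x y, ∫⁻ z in Set.Ioc u y, qIntegrand η z

/-- `G_y(a) = ∫_ℝ q(y, y + a x) μ(dx) ∈ [0,∞]`. -/
noncomputable def Gfun (η : ℝ → ℝ) (μ : Measure ℝ) (y a : ℝ) : ℝ≥0∞ :=
  ∫⁻ x, qfun η y (y + a * x) ∂μ

/-- The real-valued oriented iterated integral `∫_y^x ∫_y^u f(z) dz du`. -/
noncomputable def iterIntegral (f : ℝ → ℝ) (y x : ℝ) : ℝ :=
  ∫ u in y..x, ∫ z in y..u, f z

section iterIntegral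

variable {f : ℝ → ℝ}

theorem intervalIntegrable_of_locallyIntegrable (hf : LocallyIntegrable f volume) (s t : ℝ) :
    IntervalIntegrable f volume s t :=
  (hf.integrableOn_isCompact isCompact_uIcc).intervalIntegrable

theorem continuous_primitive_of_locallyIntegrable (hf : LocallyIntegrable f volume) (y : ℝ) :
    Continuous fun u => ∫ z in y..u, f z :=
  intervalIntegral.continuous_primitive
    (fun _ _ => intervalIntegrable_of_locallyIntegrable hf _ _) y

/-- Change of base point: `q(y,·)` and `q(b,·)` differ by an affine function. -/
theorem iterIntegral_change_base (hf : LocallyIntegrable f volume) (b y x : ℝ) :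
    iterIntegral f b x =
      iterIntegral f y x + iterIntegral f b y + (∫ z in b..y, f z) * (x - y) := by
  have hII : ∀ s t, IntervalIntegrable f volume s t := intervalIntegrable_of_locallyIntegrable hf
  have hc := continuous_primitive_of_locallyIntegrable hf
  have h1 : iterIntegral f b x =
      iterIntegral f b y + ∫ u in y..x, ∫ z in b..u, f z :=
    (intervalIntegral.integral_add_adjacent_intervals
      ((hc b).intervalIntegrable _ _) ((hc b).intervalIntegrable _ _)).symm
  have h2 : (∫ u in y..x, ∫ z in b..u, f z) =
      ∫ u in y..x, ((∫ z in b..y, f z) + ∫ z in y..u, f z) := by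
    refine intervalIntegral.integral_congr fun u _ => ?_
    exact (intervalIntegral.integral_add_adjacent_intervals (hII b y) (hII y u)).symm
  rw [h1, h2, intervalIntegral.integral_add intervalIntegrable_const
    ((hc y).intervalIntegrable _ _), intervalIntegral.integral_const, smul_eq_mul]
  unfold iterIntegral
  ring

theorem iterIntegral_eq_reversed (y x : ℝ) :
    iterIntegral f y x = ∫ u in x..y, ∫ z in u..y, f z := by
  unfold iterIntegral
  rw [intervalIntegral.integral_symm, ← intervalIntegral.integral_neg]
  refine intervalIntegral.integral_congr fun u _ => ?_
  exact (intervalIntegral.integral_symm _ _).symm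

theorem iterIntegral_nonneg (hf0 : ∀ z, 0 ≤ f z) (y x : ℝ) : 0 ≤ iterIntegral f y x := by
  rcases le_total y x with h | h
  · exact intervalIntegral.integral_nonneg h fun u hu =>
      intervalIntegral.integral_nonneg hu.1 fun z _ => hf0 z
  · rw [iterIntegral_eq_reversed]
    exact intervalIntegral.integral_nonneg h fun u hu =>
      intervalIntegral.integral_nonneg hu.2 fun z _ => hf0 z

theorem iterIntegral_le_of_le_right (hf : LocallyIntegrable f volume) (hf0 : ∀ z, 0 ≤ f z)
    {b s t : ℝ} (hbs : b ≤ s) (hst : s ≤ t) : iterIntegral f b s ≤ iterIntegral f b t := by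
  have h0 : 0 ≤ (∫ z in b..s, f z) := intervalIntegral.integral_nonneg hbs fun z _ => hf0 z
  have h1 := iterIntegral_nonneg hf0 s t
  have h2 := mul_nonneg h0 (sub_nonneg.2 hst)
  linarith [iterIntegral_change_base hf b s t]

theorem iterIntegral_le_of_le_left (hf : LocallyIntegrable f volume) (hf0 : ∀ z, 0 ≤ f z)
    {b s t : ℝ} (hsb : s ≤ b) (hts : t ≤ s) : iterIntegral f b s ≤ iterIntegral f b t := by
  have h0 : 0 ≤ (∫ z in s..b, f z) := intervalIntegral.integral_nonneg hsb fun z _ => hf0 z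
  rw [intervalIntegral.integral_symm] at h0
  have h1 := iterIntegral_nonneg hf0 s t
  have h2 := mul_nonneg h0 (sub_nonneg.2 hts)
  linarith [iterIntegral_change_base hf b s t]

/-- A shift of the endpoint is absorbed by a larger dilation and an additive constant. -/
theorem iterIntegral_shift_le (hf : LocallyIntegrable f volume) (hf0 : ∀ z, 0 ≤ f z)
    (b d x : ℝ) {a : ℝ} (ha : 0 < a) :
    iterIntegral f b (b + (d + a * x)) ≤ iterIntegral f b (b + (a + |d|) * x) +
      (iterIntegral f b (b + (a + |d|)) + iterIntegral f b (b - (a + |d|))) := by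
  have n1 := iterIntegral_nonneg hf0 b (b + (a + |d|) * x)
  have n2 := iterIntegral_nonneg hf0 b (b + (a + |d|))
  have n3 := iterIntegral_nonneg hf0 b (b - (a + |d|))
  have hd0 := abs_nonneg d
  have hd1 := le_abs_self d
  have hd2 := neg_abs_le d
  rcases le_total 0 (d + a * x) with hw | hw
  · have key : ∀ t, d + a * x ≤ t →
        iterIntegral f b (b + (d + a * x)) ≤ iterIntegral f b (b + t) := fun t ht =>
      iterIntegral_le_of_le_right hf hf0 (by linarith) (by linarith)
    rcases le_total 1 x with hx | hx
    · linarith [key ((a + |d|) * x) (by nlinarith)]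
    · linarith [key (a + |d|) (by nlinarith)]
  · have key : ∀ t, t ≤ d + a * x →
        iterIntegral f b (b + (d + a * x)) ≤ iterIntegral f b (b + t) := fun t ht =>
      iterIntegral_le_of_le_left hf hf0 (by linarith) (by linarith)
    rcases le_total x (-1) with hx | hx
    · linarith [key ((a + |d|) * x) (by nlinarith)]
    · have := key (-(a + |d|)) (by nlinarith)
      rw [← sub_eq_add_neg] at this
      linarith

theorem lintegral_Ioc_ofReal {g : ℝ → ℝ} {s t : ℝ} (hst : s ≤ t)
    (hg : IntervalIntegrable g volume s t) (hg0 : ∀ u ∈ Ioc s t, 0 ≤ g u) :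
    ∫⁻ u in Ioc s t, ENNReal.ofReal (g u) = ENNReal.ofReal (∫ u in s..t, g u) := by
  rw [intervalIntegral.integral_of_le hst]
  exact (ofReal_integral_eq_lintegral_ofReal
    ((intervalIntegrable_iff_integrableOn_Ioc_of_le hst).1 hg)
    ((ae_restrict_iff' measurableSet_Ioc).2 (ae_of_all _ hg0))).symm

end iterIntegral

theorem qIntegrand_eq_ofReal {η : ℝ → ℝ} {z : ℝ} (hz : η z ≠ 0) :
    qIntegrand η z = ENNReal.ofReal (2 * (1 / (η z) ^ 2)) := by
  have : 0 < (η z) ^ 2 := by positivity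
  rw [qIntegrand, mul_one_div, ENNReal.ofReal_div_of_pos this, ENNReal.ofReal_ofNat]

theorem qfun_eq_ofReal_iterIntegral {η : ℝ → ℝ} (hηne : ∀ x, η x ≠ 0)
    (hηloc : LocallyIntegrable (fun z => 2 * (1 / (η z) ^ 2)) volume) (y x : ℝ) :
    qfun η y x = ENNReal.ofReal (iterIntegral (fun z => 2 * (1 / (η z) ^ 2)) y x) := by
  have hf0 : ∀ z, 0 ≤ 2 * (1 / (η z) ^ 2) := fun z => by positivity
  have hinner : ∀ s t, s ≤ t → ∫⁻ z in Ioc s t, qIntegrand η z =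
      ENNReal.ofReal (∫ z in s..t, 2 * (1 / (η z) ^ 2)) := fun s t hst => by
    simp_rw [fun z => qIntegrand_eq_ofReal (hηne z)]
    exact lintegral_Ioc_ofReal hst (intervalIntegrable_of_locallyIntegrable hηloc s t)
      fun z _ => hf0 z
  have hc := continuous_primitive_of_locallyIntegrable hηloc y
  unfold qfun
  split_ifs with h
  · rw [setLIntegral_congr_fun measurableSet_Ioc fun u hu => hinner y u hu.1.le]
    exact lintegral_Ioc_ofReal h (hc.intervalIntegrable _ _) fun u hu =>
      intervalIntegral.integral_nonneg hu.1.le fun z _ => hf0 z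
  · have h' : x ≤ y := (not_le.1 h).le
    rw [setLIntegral_congr_fun measurableSet_Ioc fun u hu => hinner u y hu.2,
      iterIntegral_eq_reversed]
    refine lintegral_Ioc_ofReal h' ?_ fun u hu =>
      intervalIntegral.integral_nonneg hu.2 fun z _ => hf0 z
    refine Continuous.intervalIntegrable ?_ _ _
    simp_rw [fun u => intervalIntegral.integral_symm (μ := volume)
      (f := fun z => 2 * (1 / (η z) ^ 2)) y u]
    exact hc.neg

/-- Case 1 (`l = −∞`, `r = ∞`, so `I = ℝ`): if there exists `ȳ ∈ ℝ` with `G_ȳ(a) < ∞` for all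
`a > 0`, then `G_y(a) < ∞` for all `y ∈ ℝ` and all `a > 0`. -/
theorem Gfun_lt_top_of_exists
    (η : ℝ → ℝ) (hηmeas : Measurable η) (hηne : ∀ x : ℝ, η x ≠ 0)
    (hηloc : LocallyIntegrable (fun z => 1 / (η z) ^ 2) volume)
    (μ : Measure ℝ) [IsProbabilityMeasure μ]
    (hμint : Integrable (fun x => x) μ) (hμcen : ∫ x, x ∂μ = 0)
    (hμne : μ ≠ Measure.dirac 0)
    (ybar : ℝ) (hybar : ∀ a : ℝ, 0 < a → Gfun η μ ybar a < ⊤) :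
    ∀ y : ℝ, ∀ a : ℝ, 0 < a → Gfun η μ y a < ⊤ := by
  intro y a ha
  set f : ℝ → ℝ := fun z => 2 * (1 / (η z) ^ 2) with hfdef
  have hf : LocallyIntegrable f volume := hηloc.smul (2 : ℝ)
  have hf0 : ∀ z, 0 ≤ f z := fun z => by positivity
  have hq : ∀ y x, qfun η y x = ENNReal.ofReal (iterIntegral f y x) :=
    qfun_eq_ofReal_iterIntegral hηne hf
  set d := y - ybar with hd
  have hc : 0 < a + |d| := by positivity
  set K := iterIntegral f ybar (ybar + (a + |d|)) + iterIntegral f ybar (ybar - (a + |d|))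
  set S := ∫ z in ybar..y, f z
  have hbound : ∀ x, qfun η y (y + a * x) ≤
      qfun η ybar (ybar + (a + |d|) * x) + ENNReal.ofReal (K + |S * a * x|) := fun x => by
    rw [hq, hq, ← ENNReal.ofReal_add (iterIntegral_nonneg hf0 _ _)
      (add_nonneg (add_nonneg (iterIntegral_nonneg hf0 _ _) (iterIntegral_nonneg hf0 _ _))
        (abs_nonneg _))]
    refine ENNReal.ofReal_le_ofReal ?_
    have h1 := iterIntegral_change_base hf ybar y (y + a * x)
    have h2 := iterIntegral_shift_le hf hf0 ybar d x ha
    rw [show ybar + (d + a * x) = y + a * x by rw [hd]; ring] at h2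
    have h3 : S * (y + a * x - y) = S * a * x := by ring
    linarith [iterIntegral_nonneg hf0 ybar y, neg_abs_le (S * a * x)]
  have hint : Integrable (fun x => K + |S * a * x|) μ :=
    (integrable_const K).add (hμint.const_mul (S * a)).abs
  calc Gfun η μ y a
      ≤ ∫⁻ x, (qfun η ybar (ybar + (a + |d|) * x) + ENNReal.ofReal (K + |S * a * x|)) ∂μ :=
        lintegral_mono hbound
    _ = Gfun η μ ybar (a + |d|) + ∫⁻ x, ENNReal.ofReal (K + |S * a * x|) ∂μ :=
        lintegral_add_right _ (by fun_prop)
    _ < ⊤ := ENNReal.add_lt_top.2 ⟨hybar _ hc, hint.lintegral_lt_top⟩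
end

section
/- Lower semicontinuity: Assume the Case 2 setting and condition (A2). Then the function y ↦ G_y(ā(y)) takes values in (0,∞] and is lower semicontinuous on I, i.e. for every y₀ ∈ I one has liminf_{y → y₀} G_y(ā(y)) ≥ G_{y₀}(ā(y₀)) > 0. -/
open MeasureTheory Filter Set Topology
open scoped ENNReal

/-- Fatou's lemma as a statement on parameter integrals: the integral of a family of functions
depending lower semicontinuously on a parameter is lower semicontinuous. -/
lemma lowerSemicontinuous_lintegral {X α : Type*} [TopologicalSpace X] [FirstCountableTopology X]
    [MeasurableSpace α] {ν : Measure α} {F : X → α → ℝ≥0∞}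
    (hmeas : ∀ p, Measurable (F p)) (hlsc : ∀ a, LowerSemicontinuous fun p => F p a) :
    LowerSemicontinuous fun p => ∫⁻ a, F p a ∂ν := by
  intro p t ht
  by_contra hcon
  obtain ⟨s, hs, hst⟩ := exists_seq_forall_of_frequently (not_eventually.1 hcon)
  have hle : ∫⁻ a, F p a ∂ν ≤ t := calc
    ∫⁻ a, F p a ∂ν ≤ ∫⁻ a, liminf (fun n => F (s n) a) atTop ∂ν :=
      lintegral_mono fun a => le_of_forall_lt fun b hb => by
        obtain ⟨b', hbb', hb'⟩ := exists_between hb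
        exact hbb'.trans_le
          (le_liminf_of_le (h := (hs.eventually (hlsc a p b' hb')).mono fun _ h => h.le))
    _ ≤ liminf (fun n => ∫⁻ a, F (s n) a ∂ν) atTop := lintegral_liminf_le fun n => hmeas (s n)
    _ ≤ liminf (fun _ : ℕ => t) atTop :=
      liminf_le_liminf (Eventually.of_forall fun n => not_lt.1 (hst n))
    _ = t := liminf_const t
  exact absurd ht hle.not_gt

lemma measurable_qIntegrand {η : ℝ → ℝ} (hη : Measurable η) : Measurable (qIntegrand η) := by
  unfold qIntegrand
  fun_prop

lemma qIntegrand_pos (η : ℝ → ℝ) (z : ℝ) : 0 < qIntegrand η z :=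
  ENNReal.div_pos (by norm_num) ENNReal.ofReal_ne_top

/-- The open set of parameters `(y, x)` for which `z` lies strictly between `y` and `u`, and `u`
strictly between `z` and `x`. -/
def qRegion (u z : ℝ) : Set (ℝ × ℝ) :=
  {p | p.1 < z ∧ z < u ∧ u < p.2 ∨ p.2 < u ∧ u < z ∧ z < p.1}

lemma isOpen_qRegion (u z : ℝ) : IsOpen (qRegion u z) := by
  have h1 : IsOpen {p : ℝ × ℝ | p.1 < z ∧ z < u ∧ u < p.2} :=
    (isOpen_lt continuous_fst continuous_const).inter
      (isOpen_const.inter (isOpen_lt continuous_const continuous_snd))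
  have h2 : IsOpen {p : ℝ × ℝ | p.2 < u ∧ u < z ∧ z < p.1} :=
    (isOpen_lt continuous_snd continuous_const).inter
      (isOpen_const.inter (isOpen_lt continuous_const continuous_fst))
  exact h1.union h2

lemma setLIntegral_Ioc_eq_lintegral_indicator_Ioo (f : ℝ → ℝ≥0∞) (a b : ℝ) :
    ∫⁻ z in Ioc a b, f z = ∫⁻ z, (Ioo a b).indicator f z := by
  rw [lintegral_indicator measurableSet_Ioo, setLIntegral_congr Ioo_ae_eq_Ioc]

lemma qfun_eq_lintegral_indicator (η : ℝ → ℝ) (y x : ℝ) :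
    qfun η y x =
      ∫⁻ u, ∫⁻ z, (qRegion u z).indicator (fun _ => qIntegrand η z) (y, x) := by
  unfold qfun
  split_ifs with h
  all_goals
    simp only [setLIntegral_Ioc_eq_lintegral_indicator_Ioo]
    refine lintegral_congr fun u => ?_
    by_cases hu : u ∈ Ioo y x ∨ u ∈ Ioo x y
    · simp only [mem_Ioo] at hu
      have hu' : x < u ∧ u < y ∨ y < u ∧ u < x := hu.symm
      rw [indicator_of_mem (by simp only [mem_Ioo]; grind)]
      refine lintegral_congr fun z => ?_
      simp only [indicator, qRegion, mem_Ioo, mem_ofPred_eq]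
      congr 1
      grind
    · simp only [mem_Ioo] at hu
      rw [indicator_of_notMem (by simp only [mem_Ioo]; grind)]
      symm
      rw [lintegral_eq_zero_of_ae_eq_zero]
      refine Eventually.of_forall fun z => indicator_of_notMem ?_ _
      simp only [qRegion, mem_ofPred_eq]
      grind

lemma measurable_indicator_qRegion {η : ℝ → ℝ} (hη : Measurable η) (p : ℝ × ℝ) :
    Measurable fun w : ℝ × ℝ => (qRegion w.1 w.2).indicator (fun _ => qIntegrand η w.2) p := by
  have hset : MeasurableSet {w : ℝ × ℝ | p ∈ qRegion w.1 w.2} := by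
    simp only [qRegion, mem_ofPred_eq]
    measurability
  classical
  simp only [indicator]
  exact Measurable.ite hset ((measurable_qIntegrand hη).comp measurable_snd) measurable_const

lemma lowerSemicontinuous_qfun {η : ℝ → ℝ} (hη : Measurable η) :
    LowerSemicontinuous fun p : ℝ × ℝ => qfun η p.1 p.2 := by
  simp only [qfun_eq_lintegral_indicator]
  refine lowerSemicontinuous_lintegral
    (fun p => (measurable_indicator_qRegion hη p).lintegral_prod_right') fun u => ?_
  refine lowerSemicontinuous_lintegral
    (fun p => (measurable_indicator_qRegion hη p).comp measurable_prodMk_left) fun z => ?_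
  exact (isOpen_qRegion u z).lowerSemicontinuous_indicator zero_le

lemma measurable_qfun_affine {η : ℝ → ℝ} (hη : Measurable η) (y a : ℝ) :
    Measurable fun x => qfun η y (y + a * x) :=
  ((lowerSemicontinuous_qfun hη).comp (g := fun x : ℝ => (y, y + a * x))
    (by fun_prop)).measurable

lemma lowerSemicontinuous_Gfun {η : ℝ → ℝ} (hη : Measurable η) (μ : Measure ℝ) {a : ℝ → ℝ}
    (ha : Continuous a) : LowerSemicontinuous fun y => Gfun η μ y (a y) :=
  lowerSemicontinuous_lintegral (fun y => measurable_qfun_affine hη y (a y)) fun x =>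
    (lowerSemicontinuous_qfun hη).comp (g := fun y : ℝ => (y, y + a y * x)) (by fun_prop)

lemma qfun_pos_of_lt {η : ℝ → ℝ} (hη : Measurable η) {y x : ℝ} (h : x < y) :
    0 < qfun η y x := by
  have hinner : ∀ u < y, 0 < ∫⁻ z in Ioc u y, qIntegrand η z := fun u hu => by
    rw [setLIntegral_pos_iff (measurable_qIntegrand hη)]
    simpa [Function.support_eq_univ fun z => (qIntegrand_pos η z).ne'] using hu
  rw [qfun, if_neg h.not_ge, setLIntegral_congr Ioo_ae_eq_Ioc.symm]
  have hanti : Antitone fun u => ∫⁻ z in Ioc u y, qIntegrand η z := fun u v huv =>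
    lintegral_mono_set (Ioc_subset_Ioc_left huv)
  rw [setLIntegral_pos_iff hanti.measurable]
  refine lt_of_lt_of_le (by simpa using h)
    (measure_mono (subset_inter (fun u hu => (hinner u hu.2).ne') (subset_refl (Ioo x y))))

/-- A centered probability measure on the line which is not the Dirac mass at `0` charges the
negative half-line. -/
lemma measure_Iio_zero_ne_zero_of_centered {μ : Measure ℝ} [IsProbabilityMeasure μ]
    (hint : Integrable (fun x => x) μ) (hcen : ∫ x, x ∂μ = 0) (hne : μ ≠ Measure.dirac 0) :
    μ (Iio 0) ≠ 0 := by
  intro h0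
  have hnn : 0 ≤ᵐ[μ] fun x : ℝ => x := by
    rw [EventuallyLE, ae_iff]
    simpa [Iio] using h0
  have hz : (fun x : ℝ => x) =ᵐ[μ] fun _ => 0 := (integral_eq_zero_iff_of_nonneg_ae hnn hint).1 hcen
  refine hne ?_
  calc μ = μ.map fun x => x := Measure.map_id'.symm
    _ = μ.map fun _ => 0 := Measure.map_congr hz
    _ = Measure.dirac 0 := by simp

lemma Gfun_pos {η : ℝ → ℝ} (hη : Measurable η) {μ : Measure ℝ} (hμ : μ (Iio 0) ≠ 0) (y : ℝ)
    {a : ℝ} (ha : 0 < a) : 0 < Gfun η μ y a := by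
  rw [Gfun, lintegral_pos_iff_support (measurable_qfun_affine hη y a)]
  refine (pos_iff_ne_zero.2 hμ).trans_le (measure_mono fun x hx => ?_)
  have := mul_neg_of_pos_of_neg ha hx
  exact (qfun_pos_of_lt hη (by linarith)).ne'

/-- **Lower semicontinuity** (Case 2: `I = (l,∞)`, condition (A2)).
Here `c = inf supp μ` (characterized by `μ((−∞,c)) = 0` and `μ((−∞,c+ε)) > 0` for all
`ε > 0`) and `ā(y) = (l−y)/c`.  The function `y ↦ G_y(ā(y))` takes values in `(0,∞]` and is
lower semicontinuous on `I`. -/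
theorem Gfun_abar_pos_and_lowerSemicontinuousOn
    (l : ℝ) (η : ℝ → ℝ) (hηmeas : Measurable η)
    (hηne : ∀ x ∈ Set.Ioi l, η x ≠ 0) (hηzero : ∀ x ∉ Set.Ioi l, η x = 0)
    (hηloc : LocallyIntegrableOn (fun z => 1 / (η z) ^ 2) (Set.Ioi l) volume)
    (μ : Measure ℝ) [IsProbabilityMeasure μ]
    (hμint : Integrable (fun x => x) μ) (hμcen : ∫ x, x ∂μ = 0)
    (hμne : μ ≠ Measure.dirac 0)
    (c : ℝ) (hc_null : μ (Set.Iio c) = 0) (hc_inf : ∀ ε > (0 : ℝ), 0 < μ (Set.Iio (c + ε)))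
    (hA2 : ∃ y ∈ Set.Ioi l, ∀ a : ℝ, 0 < a →
      ∫⁻ x in Set.Ici (0 : ℝ), qfun η y (y + a * x) ∂μ < ⊤) :
    (∀ y ∈ Set.Ioi l, 0 < Gfun η μ y ((l - y) / c)) ∧
    LowerSemicontinuousOn (fun y => Gfun η μ y ((l - y) / c)) (Set.Ioi l) := by
  have hneg := measure_Iio_zero_ne_zero_of_centered hμint hμcen hμne
  have hc : c < 0 := by
    by_contra! h
    exact hneg (measure_mono_null (Iio_subset_Iio h) hc_null)
  refine ⟨fun y hy => Gfun_pos hηmeas hneg y (div_pos_of_neg_of_neg (sub_neg.2 hy) hc), ?_⟩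
  exact (lowerSemicontinuous_Gfun hηmeas μ (by fun_prop)).lowerSemicontinuousOn _
end

section
/- Assume the Case 2 setting and condition (A2), and suppose that lim_{x↘l} q(y₀,x) = ∞ for some (equivalently, every) y₀ ∈ I. If μ({inf supp μ}) > 0, then G_y(ā(y)) = ∞ for every y ∈ I; in particular liminf_{y→∞} G_y(ā(y)) > 0 and liminf_{y↘l} G_y(ā(y)) > 0. -/
open MeasureTheory Filter Set Topology
open scoped ENNReal

/-- The integrand is integrable over compact subintervals on which `1/η²` is. -/
theorem lintegral_qIntegrand_lt_top {η : ℝ → ℝ} {a b : ℝ} (hη : ∀ x ∈ Set.Ioc a b, η x ≠ 0)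
    (hint : IntegrableOn (fun z => 1 / (η z) ^ 2) (Set.Ioc a b) volume) :
    ∫⁻ z in Set.Ioc a b, qIntegrand η z < ⊤ := by
  have h := (hint.const_mul 2).lintegral_lt_top
  refine lt_of_eq_of_lt (setLIntegral_congr_fun measurableSet_Ioc fun z hz => ?_) h
  have hpos : 0 < η z ^ 2 := by have := hη z hz; positivity
  simp only [qIntegrand]
  rw [mul_one_div, ENNReal.ofReal_div_of_pos hpos, ENNReal.ofReal_ofNat]

/-- To the left of the base point, `q(y,·)` is antitone. -/
theorem qfun_le_qfun_of_le_left {η : ℝ → ℝ} {l x y : ℝ} (hlx : l ≤ x) (hxy : x < y) :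
    qfun η y x ≤ qfun η y l := by
  rw [qfun, qfun, if_neg hxy.not_ge, if_neg (hlx.trans_lt hxy).not_ge]
  exact lintegral_mono_set (Set.Ioc_subset_Ioc_left hlx)

/-- To the left of both base points, `q(·,l)` is monotone. -/
theorem qfun_le_qfun_of_base_le {η : ℝ → ℝ} {l y y' : ℝ} (hly : l < y) (hyy' : y ≤ y') :
    qfun η y l ≤ qfun η y' l := by
  rw [qfun, qfun, if_neg hly.not_ge, if_neg (hly.trans_le hyy').not_ge]
  exact (lintegral_mono fun u => lintegral_mono_set (Set.Ioc_subset_Ioc_right hyy')).trans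
    (lintegral_mono_set (Set.Ioc_subset_Ioc_right hyy'))

/-- Moving the base point to the right adds at most a linear term. -/
theorem qfun_le_qfun_add {η : ℝ → ℝ} {l y y' : ℝ} (hly : l < y) (hyy' : y ≤ y') :
    qfun η y' l ≤ qfun η y l +
      (∫⁻ z in Set.Ioc y y', qIntegrand η z) * ENNReal.ofReal (y' - l) := by
  rw [qfun, qfun, if_neg hly.not_ge, if_neg (hly.trans_le hyy').not_ge]
  have hsplit : ∀ u, ∫⁻ z in Set.Ioc u y', qIntegrand η z ≤
      (∫⁻ z in Set.Ioc u y, qIntegrand η z) + ∫⁻ z in Set.Ioc y y', qIntegrand η z :=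
    fun u => (lintegral_mono_set Set.Ioc_subset_Ioc_union_Ioc).trans (lintegral_union_le _ _ _)
  have hzero : ∫⁻ u in Set.Ioc y y', ∫⁻ z in Set.Ioc u y, qIntegrand η z = 0 := by
    rw [setLIntegral_congr_fun (g := fun _ => 0) measurableSet_Ioc fun u hu => by
      simp [Set.Ioc_eq_empty_of_le hu.1.le], lintegral_zero]
  refine (lintegral_mono hsplit).trans ?_
  rw [lintegral_add_right _ measurable_const, setLIntegral_const, Real.volume_Ioc]
  refine add_le_add ?_ le_rfl
  rw [← Set.Ioc_union_Ioc_eq_Ioc hly.le hyy']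
  exact (lintegral_union_le _ _ _).trans (by rw [hzero, add_zero])

/-- If `q(y₀,·)` explodes at `l` for one base point, then `q(y,l) = ∞` for all of them. -/
theorem qfun_left_endpoint_eq_top {η : ℝ → ℝ} {l : ℝ} (hηne : ∀ x ∈ Set.Ioi l, η x ≠ 0)
    (hηloc : LocallyIntegrableOn (fun z => 1 / (η z) ^ 2) (Set.Ioi l) volume)
    {y₀ : ℝ} (hy₀ : l < y₀) (hq : Tendsto (fun x => qfun η y₀ x) (𝓝[>] l) (𝓝 ⊤))
    {y : ℝ} (hy : l < y) : qfun η y l = ⊤ := by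
  have h₀ : qfun η y₀ l = ⊤ := top_le_iff.1 <| le_of_tendsto hq <| by
    filter_upwards [Ioo_mem_nhdsGT hy₀] with x hx
    exact qfun_le_qfun_of_le_left hx.1.le hx.2
  rcases le_total y₀ y with h | h
  · exact top_le_iff.1 (h₀ ▸ qfun_le_qfun_of_base_le hy₀ h)
  · have hfin : ∫⁻ z in Set.Ioc y y₀, qIntegrand η z < ⊤ :=
      lintegral_qIntegrand_lt_top (fun x hx => hηne x (hy.trans hx.1))
        ((hηloc.integrableOn_compact_subset (fun x hx => hy.trans_le hx.1)
          isCompact_Icc).mono_set Set.Ioc_subset_Icc_self)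
    have hle := qfun_le_qfun_add (η := η) hy h
    rw [h₀, top_le_iff, ENNReal.add_eq_top] at hle
    exact hle.resolve_right (ENNReal.mul_lt_top hfin ENNReal.ofReal_lt_top).ne

/-- A centered probability measure carried by `[0,∞)` is the Dirac mass at `0`. -/
theorem eq_dirac_zero_of_centered {μ : Measure ℝ} [IsProbabilityMeasure μ]
    (hμint : Integrable (fun x => x) μ) (hμcen : ∫ x, x ∂μ = 0) (hμ : μ (Set.Iio 0) = 0) :
    μ = Measure.dirac 0 := by
  have hnn : 0 ≤ᵐ[μ] fun x : ℝ => x := by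
    rw [EventuallyLE, ae_iff]
    simpa [Set.Iio] using hμ
  have hz : (fun x : ℝ => x) =ᵐ[μ] fun _ => 0 :=
    (integral_eq_zero_iff_of_nonneg_ae hnn hμint).1 hμcen
  rw [← Measure.map_id' (μ := μ), Measure.map_congr hz, Measure.map_const, measure_univ, one_smul]

/-- Case 2 (`I = (l,∞)`), condition (A2), inaccessible left endpoint
(`q(y₀,x) → ∞` as `x ↘ l` for some `y₀ ∈ I`): if `μ({inf supp μ}) > 0` then
`G_y(ā(y)) = ∞` for every `y ∈ I`; in particular
`liminf_{y→∞} G_y(ā(y)) > 0` and `liminf_{y↘l} G_y(ā(y)) > 0`.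
Here `c = inf supp μ` and `ā(y) = (l−y)/c`. -/
theorem Gfun_abar_top_of_atom
    (l : ℝ) (η : ℝ → ℝ) (hηmeas : Measurable η)
    (hηne : ∀ x ∈ Set.Ioi l, η x ≠ 0) (hηzero : ∀ x ∉ Set.Ioi l, η x = 0)
    (hηloc : LocallyIntegrableOn (fun z => 1 / (η z) ^ 2) (Set.Ioi l) volume)
    (μ : Measure ℝ) [IsProbabilityMeasure μ]
    (hμint : Integrable (fun x => x) μ) (hμcen : ∫ x, x ∂μ = 0)
    (hμne : μ ≠ Measure.dirac 0)
    (c : ℝ) (hc_null : μ (Set.Iio c) = 0) (hc_inf : ∀ ε > (0 : ℝ), 0 < μ (Set.Iio (c + ε)))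
    (hA2 : ∃ y ∈ Set.Ioi l, ∀ a : ℝ, 0 < a →
      ∫⁻ x in Set.Ici (0 : ℝ), qfun η y (y + a * x) ∂μ < ⊤)
    (hql : ∃ y₀ ∈ Set.Ioi l, Tendsto (fun x => qfun η y₀ x) (𝓝[>] l) (𝓝 ⊤))
    (hatom : 0 < μ {c}) :
    (∀ y ∈ Set.Ioi l, Gfun η μ y ((l - y) / c) = ⊤) ∧
    0 < Filter.liminf (fun y => Gfun η μ y ((l - y) / c)) atTop ∧
    0 < Filter.liminf (fun y => Gfun η μ y ((l - y) / c)) (𝓝[>] l) := by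
  have hc : c ≠ 0 := by
    rintro rfl
    exact hμne (eq_dirac_zero_of_centered hμint hμcen hc_null)
  obtain ⟨y₀, hy₀, hq⟩ := hql
  have hG : ∀ y ∈ Set.Ioi l, Gfun η μ y ((l - y) / c) = ⊤ := by
    intro y hy
    have hle : ∫⁻ x in {c}, qfun η y (y + (l - y) / c * x) ∂μ ≤ Gfun η μ y ((l - y) / c) :=
      setLIntegral_le_lintegral _ _
    rw [lintegral_singleton, div_mul_cancel₀ _ hc, add_sub_cancel,
      qfun_left_endpoint_eq_top hηne hηloc hy₀ hq hy, ENNReal.top_mul hatom.ne'] at hle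
    exact top_le_iff.1 hle
  have hliminf : ∀ f : Filter ℝ, f.NeBot → Set.Ioi l ∈ f →
      0 < Filter.liminf (fun y => Gfun η μ y ((l - y) / c)) f := by
    intro f _ hf
    rw [liminf_congr (v := fun _ => ⊤) (by filter_upwards [hf] with y hy using hG y hy),
      liminf_const]
    exact ENNReal.zero_lt_top
  exact ⟨hG, hliminf _ inferInstance (Ioi_mem_atTop l), hliminf _ inferInstance self_mem_nhdsWithin⟩
end

section
/- Assume the Case 2 setting and condition (A2). If limsup_{x↘l} |η(x)|/(x−l) < ∞ and limsup_{x→∞} |η(x)|/x < ∞, then liminf_{y↘l} G_y(ā(y)) > 0 and liminf_{y→∞} G_y(ā(y)) > 0. -/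
open MeasureTheory Filter Set Topology
open scoped ENNReal

/-- If `|η| ≤ D s` on `(y - s/2, y]`, then `q(y, x)` is bounded below, uniformly in `s` and
`x ≤ y - s/2`. -/
theorem le_qfun_of_abs_le {η : ℝ → ℝ} {D s x y : ℝ} (hD : 0 < D) (hs : 0 < s)
    (hx : x ≤ y - s / 2) (hη : ∀ z ∈ Set.Ioc (y - s / 2) y, |η z| ≤ D * s) :
    ENNReal.ofReal (1 / (8 * D ^ 2)) ≤ qfun η y x := by
  have hDs : 0 < (D * s) ^ 2 := by positivity
  have hq : ∀ z ∈ Set.Ioc (y - s / 2) y,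
      ENNReal.ofReal (2 / (D * s) ^ 2) ≤ qIntegrand η z := fun z hz => by
    rw [ENNReal.ofReal_div_of_pos hDs, ENNReal.ofReal_ofNat]
    refine ENNReal.div_le_div_left (ENNReal.ofReal_le_ofReal ?_) _
    rw [← sq_abs (η z)]
    exact pow_le_pow_left₀ (abs_nonneg _) (hη z hz) 2
  have hinner : ∀ u ∈ Set.Ioc (y - s / 2) (y - s / 4),
      ENNReal.ofReal (2 / (D * s) ^ 2 * (s / 4)) ≤ ∫⁻ z in Set.Ioc u y, qIntegrand η z := by
    intro u hu
    calc ENNReal.ofReal (2 / (D * s) ^ 2 * (s / 4))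
        = ∫⁻ _ in Set.Ioc (y - s / 4) y, ENNReal.ofReal (2 / (D * s) ^ 2) := by
          rw [setLIntegral_const, Real.volume_Ioc, ENNReal.ofReal_mul (by positivity)]
          congr 2
          ring
      _ ≤ ∫⁻ z in Set.Ioc (y - s / 4) y, qIntegrand η z :=
          setLIntegral_mono' measurableSet_Ioc fun z hz =>
            hq z ⟨by linarith [hz.1], hz.2⟩
      _ ≤ ∫⁻ z in Set.Ioc u y, qIntegrand η z :=
          lintegral_mono_set (Set.Ioc_subset_Ioc_left hu.2)
  rw [qfun, if_neg (by linarith)]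
  calc ENNReal.ofReal (1 / (8 * D ^ 2))
      = ∫⁻ _ in Set.Ioc (y - s / 2) (y - s / 4),
          ENNReal.ofReal (2 / (D * s) ^ 2 * (s / 4)) := by
        rw [setLIntegral_const, Real.volume_Ioc, ← ENNReal.ofReal_mul (by positivity)]
        congr 1
        field_simp
        ring
    _ ≤ ∫⁻ u in Set.Ioc (y - s / 2) (y - s / 4), ∫⁻ z in Set.Ioc u y, qIntegrand η z :=
        setLIntegral_mono' measurableSet_Ioc hinner
    _ ≤ ∫⁻ u in Set.Ioc x y, ∫⁻ z in Set.Ioc u y, qIntegrand η z :=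
        lintegral_mono_set (Set.Ioc_subset_Ioc hx (by linarith))

/-- If `|η| ≤ D (y - l)` on `(y - (y - l)/2, y]`, then `G_y((l - y)/c)` is bounded below,
uniformly in `y > l`. -/
theorem le_Gfun_of_abs_le {η : ℝ → ℝ} (μ : Measure ℝ) {c l D y : ℝ} (hc : c < 0) (hD : 0 < D)
    (hy : l < y) (hη : ∀ z ∈ Set.Ioc (y - (y - l) / 2) y, |η z| ≤ D * (y - l)) :
    ENNReal.ofReal (1 / (8 * D ^ 2)) * μ (Set.Iio (c / 2)) ≤ Gfun η μ y ((l - y) / c) := by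
  rw [← setLIntegral_const]
  refine (setLIntegral_mono' measurableSet_Iio fun x hx => ?_).trans
    (setLIntegral_le_lintegral _ _)
  refine le_qfun_of_abs_le hD (sub_pos.2 hy) ?_ hη
  have hx' : 1 / 2 ≤ x / c := by
    rw [le_div_iff_of_neg hc]
    linarith [Set.mem_Iio.1 hx]
  have : (l - y) / c * x = -((y - l) * (x / c)) := by ring
  rw [this]
  nlinarith [mul_le_mul_of_nonneg_left hx' (sub_pos.2 hy).le]

/-- A centered probability measure on `[c, ∞)` other than `δ₀` has `c < 0`. -/
theorem neg_of_measure_Iio_eq_zero {μ : Measure ℝ} [IsProbabilityMeasure μ]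
    (hint : Integrable (fun x => x) μ) (hcen : ∫ x, x ∂μ = 0) (hne : μ ≠ Measure.dirac 0)
    {c : ℝ} (hc : μ (Set.Iio c) = 0) : c < 0 := by
  by_contra! h
  have hnonneg : 0 ≤ᵐ[μ] fun x : ℝ => x := by
    filter_upwards [measure_eq_zero_iff_ae_notMem.1 hc] with x hx
    exact h.trans (not_lt.1 hx)
  have hzero : (fun x : ℝ => x) =ᵐ[μ] fun _ => 0 :=
    (integral_eq_zero_iff_of_nonneg_ae hnonneg hint).1 hcen
  apply hne
  calc μ = μ.map (fun x => x) := Measure.map_id'.symm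
    _ = μ.map (fun _ => 0) := Measure.map_congr hzero
    _ = Measure.dirac 0 := by simp [Measure.map_const]

/-- Case 2 (`I = (l,∞)`), condition (A2): if `limsup_{x↘l} |η(x)|/(x−l) < ∞` and
`limsup_{x→∞} |η(x)|/x < ∞`, then `liminf_{y↘l} G_y(ā(y)) > 0` and
`liminf_{y→∞} G_y(ā(y)) > 0`.
Here `c = inf supp μ` and `ā(y) = (l−y)/c`. -/
theorem Gfun_abar_liminf_pos_of_eta_linear_bound
    (l : ℝ) (η : ℝ → ℝ) (hηmeas : Measurable η)
    (hηne : ∀ x ∈ Set.Ioi l, η x ≠ 0) (hηzero : ∀ x ∉ Set.Ioi l, η x = 0)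
    (hηloc : LocallyIntegrableOn (fun z => 1 / (η z) ^ 2) (Set.Ioi l) volume)
    (μ : Measure ℝ) [IsProbabilityMeasure μ]
    (hμint : Integrable (fun x => x) μ) (hμcen : ∫ x, x ∂μ = 0)
    (hμne : μ ≠ Measure.dirac 0)
    (c : ℝ) (hc_null : μ (Set.Iio c) = 0) (hc_inf : ∀ ε > (0 : ℝ), 0 < μ (Set.Iio (c + ε)))
    (hA2 : ∃ y ∈ Set.Ioi l, ∀ a : ℝ, 0 < a →
      ∫⁻ x in Set.Ici (0 : ℝ), qfun η y (y + a * x) ∂μ < ⊤)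
    (hl : ∃ C : ℝ, ∀ᶠ x in 𝓝[>] l, |η x| ≤ C * (x - l))
    (hinfty : ∃ C : ℝ, ∀ᶠ x in atTop, |η x| ≤ C * x) :
    0 < Filter.liminf (fun y => Gfun η μ y ((l - y) / c)) (𝓝[>] l) ∧
    0 < Filter.liminf (fun y => Gfun η μ y ((l - y) / c)) atTop := by
  have hc : c < 0 := neg_of_measure_Iio_eq_zero hμint hμcen hμne hc_null
  have hμpos : 0 < μ (Set.Iio (c / 2)) := by
    have := hc_inf (-c / 2) (by linarith)
    rwa [show c + -c / 2 = c / 2 by ring] at this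
  have key : ∀ (F : Filter ℝ) (D : ℝ), 0 < D →
      (∀ᶠ y in F, l < y ∧ ∀ z ∈ Set.Ioc (y - (y - l) / 2) y, |η z| ≤ D * (y - l)) →
      0 < Filter.liminf (fun y => Gfun η μ y ((l - y) / c)) F := fun F D hD hF =>
    (ENNReal.mul_pos (ENNReal.ofReal_pos.2 (by positivity)).ne' hμpos.ne').trans_le <|
      le_liminf_of_le (by isBoundedDefault) <|
        hF.mono fun y hy => le_Gfun_of_abs_le μ hc hD hy.1 hy.2
  constructor
  · obtain ⟨C, hC⟩ := hl
    obtain ⟨b, hb, hbC⟩ := (mem_nhdsGT_iff_exists_Ioo_subset).1 hC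
    refine key _ (max C 1) (by positivity) ?_
    filter_upwards [Ioo_mem_nhdsGT hb] with y hy
    refine ⟨hy.1, fun z hz => ?_⟩
    have hlz : l < z := by linarith [hz.1, hy.1]
    calc |η z| ≤ C * (z - l) := hbC ⟨hlz, hz.2.trans_lt hy.2⟩
      _ ≤ max C 1 * (y - l) :=
        mul_le_mul (le_max_left _ _) (by linarith [hz.2]) (by linarith) (by positivity)
  · obtain ⟨C, hC⟩ := hinfty
    obtain ⟨b, hb⟩ := eventually_atTop.1 hC
    refine key _ (2 * max C 1) (by positivity) ?_
    filter_upwards [eventually_gt_atTop l, eventually_ge_atTop (2 * l),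
      eventually_ge_atTop (2 * b - l), eventually_ge_atTop (-l)] with y hly h2l h2b hl'
    refine ⟨hly, fun z hz => ?_⟩
    have hz0 : 0 ≤ z := by linarith [hz.1]
    calc |η z| ≤ C * z := hb z (by linarith [hz.1])
      _ ≤ max C 1 * (2 * (y - l)) :=
        mul_le_mul (le_max_left _ _) (by linarith [hz.2]) hz0 (by positivity)
      _ = 2 * max C 1 * (y - l) := by ring
end

section
/- Statement (Eq): Assume the Case 2 setting and condition (A2). For N ∈ ℕ define a_N(y) := sup{a ∈ [0,∞) : G_y(a) ≤ 1/N} for y ∈ I. Then for every compact subinterval J ⊂ I there exists N₁ ∈ ℕ such that for all N ≥ N₁ and all y ∈ J one has G_y(a_N(y)) = 1/N. -/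
open MeasureTheory Filter Set Topology
open scoped ENNReal

/-- Integrating out the outer variable in `qfun η y x` leaves the weight `tentKernel y x z` on
`qIntegrand η z`. -/
noncomputable def tentKernel (y x z : ℝ) : ℝ≥0∞ :=
  if y < z then ENNReal.ofReal (x - z) else ENNReal.ofReal (z - x)

lemma measurable_tentKernel (y : ℝ) : Measurable fun p : ℝ × ℝ => tentKernel y p.1 p.2 := by
  unfold tentKernel
  refine Measurable.ite (measurableSet_lt measurable_const measurable_snd) ?_ ?_ <;> fun_prop

lemma qIntegrand_eq_top {η : ℝ → ℝ} {z : ℝ} (hz : η z = 0) : qIntegrand η z = ⊤ := by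
  simp [qIntegrand, hz, ENNReal.div_zero]

lemma setLIntegral_triangle_upper {f : ℝ → ℝ≥0∞} (hf : Measurable f) (y x : ℝ) :
    ∫⁻ u in Ioc y x, ∫⁻ z in Ioc y u, f z = ∫⁻ z in Ioi y, f z * ENNReal.ofReal (x - z) := by
  have hS : MeasurableSet {p : ℝ × ℝ | p.1 ≤ x ∧ y < p.2 ∧ p.2 ≤ p.1} := by measurability
  calc ∫⁻ u in Ioc y x, ∫⁻ z in Ioc y u, f z
      = ∫⁻ u, ∫⁻ z, {p : ℝ × ℝ | p.1 ≤ x ∧ y < p.2 ∧ p.2 ≤ p.1}.indicator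
          (fun p => f p.2) (u, z) := by
        rw [← lintegral_indicator measurableSet_Ioc]
        refine lintegral_congr fun u => ?_
        by_cases hu : u ∈ Ioc y x
        · rw [indicator_of_mem hu, ← lintegral_indicator measurableSet_Ioc]
          refine lintegral_congr fun z => ?_
          have := hu.2
          by_cases hz : z ∈ Ioc y u
          · rw [indicator_of_mem hz, indicator_of_mem]
            exact ⟨this, hz.1, hz.2⟩
          · rw [indicator_of_notMem hz, indicator_of_notMem]
            exact fun h => hz h.2
        · rw [indicator_of_notMem hu]
          symm
          rw [lintegral_eq_zero_of_ae_eq_zero]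
          refine Eventually.of_forall fun z => indicator_of_notMem ?_ _
          exact fun h => hu ⟨h.2.1.trans_le h.2.2, h.1⟩
    _ = ∫⁻ z, ∫⁻ u, {p : ℝ × ℝ | p.1 ≤ x ∧ y < p.2 ∧ p.2 ≤ p.1}.indicator
          (fun p => f p.2) (u, z) :=
        lintegral_lintegral_swap ((hf.comp measurable_snd).indicator hS).aemeasurable
    _ = ∫⁻ z in Ioi y, f z * ENNReal.ofReal (x - z) := by
        rw [← lintegral_indicator measurableSet_Ioi]
        refine lintegral_congr fun z => ?_
        by_cases hz : y < z
        · rw [indicator_of_mem (mem_Ioi.2 hz), ← Real.volume_Icc,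
            ← lintegral_indicator_const measurableSet_Icc]
          refine lintegral_congr fun u => ?_
          by_cases hu : u ∈ Icc z x
          · rw [indicator_of_mem hu, indicator_of_mem]
            exact ⟨hu.2, hz, hu.1⟩
          · rw [indicator_of_notMem hu, indicator_of_notMem]
            exact fun h => hu ⟨h.2.2, h.1⟩
        · rw [indicator_of_notMem (by simpa using hz), lintegral_eq_zero_of_ae_eq_zero]
          refine Eventually.of_forall fun u => indicator_of_notMem ?_ _
          exact fun h => hz h.2.1

lemma setLIntegral_triangle_lower {f : ℝ → ℝ≥0∞} (hf : Measurable f) (y x : ℝ) :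
    ∫⁻ u in Ioc x y, ∫⁻ z in Ioc u y, f z = ∫⁻ z in Iic y, f z * ENNReal.ofReal (z - x) := by
  have hS : MeasurableSet {p : ℝ × ℝ | x < p.1 ∧ p.1 < p.2 ∧ p.2 ≤ y} := by measurability
  calc ∫⁻ u in Ioc x y, ∫⁻ z in Ioc u y, f z
      = ∫⁻ u, ∫⁻ z, {p : ℝ × ℝ | x < p.1 ∧ p.1 < p.2 ∧ p.2 ≤ y}.indicator
          (fun p => f p.2) (u, z) := by
        rw [← lintegral_indicator measurableSet_Ioc]
        refine lintegral_congr fun u => ?_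
        by_cases hu : u ∈ Ioc x y
        · rw [indicator_of_mem hu, ← lintegral_indicator measurableSet_Ioc]
          refine lintegral_congr fun z => ?_
          have := hu.1
          by_cases hz : z ∈ Ioc u y
          · rw [indicator_of_mem hz, indicator_of_mem]
            exact ⟨this, hz.1, hz.2⟩
          · rw [indicator_of_notMem hz, indicator_of_notMem]
            exact fun h => hz h.2
        · rw [indicator_of_notMem hu]
          symm
          rw [lintegral_eq_zero_of_ae_eq_zero]
          refine Eventually.of_forall fun z => indicator_of_notMem ?_ _
          exact fun h => hu ⟨h.1, h.2.1.le.trans h.2.2⟩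
    _ = ∫⁻ z, ∫⁻ u, {p : ℝ × ℝ | x < p.1 ∧ p.1 < p.2 ∧ p.2 ≤ y}.indicator
          (fun p => f p.2) (u, z) :=
        lintegral_lintegral_swap ((hf.comp measurable_snd).indicator hS).aemeasurable
    _ = ∫⁻ z in Iic y, f z * ENNReal.ofReal (z - x) := by
        rw [← lintegral_indicator measurableSet_Iic]
        refine lintegral_congr fun z => ?_
        by_cases hz : z ≤ y
        · rw [indicator_of_mem (mem_Iic.2 hz), ← Real.volume_Ioo,
            ← lintegral_indicator_const measurableSet_Ioo]
          refine lintegral_congr fun u => ?_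
          by_cases hu : u ∈ Ioo x z
          · rw [indicator_of_mem hu, indicator_of_mem]
            exact ⟨hu.1, hu.2, hz⟩
          · rw [indicator_of_notMem hu, indicator_of_notMem]
            exact fun h => hu ⟨h.1, h.2.1⟩
        · rw [indicator_of_notMem (by simpa using hz), lintegral_eq_zero_of_ae_eq_zero]
          refine Eventually.of_forall fun u => indicator_of_notMem ?_ _
          exact fun h => hz h.2.2

lemma qfun_eq_lintegral {η : ℝ → ℝ} (hη : Measurable η) (y x : ℝ) :
    qfun η y x = ∫⁻ z, qIntegrand η z * tentKernel y x z := by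
  have hf := measurable_qIntegrand hη
  unfold qfun
  split_ifs with h
  · rw [setLIntegral_triangle_upper hf, ← lintegral_indicator measurableSet_Ioi]
    refine lintegral_congr fun z => ?_
    by_cases hz : y < z
    · rw [indicator_of_mem (mem_Ioi.2 hz), tentKernel, if_pos hz]
    · rw [indicator_of_notMem (by simpa using hz), tentKernel, if_neg hz,
        ENNReal.ofReal_of_nonpos (by linarith), mul_zero]
  · rw [setLIntegral_triangle_lower hf, ← lintegral_indicator measurableSet_Iic]
    refine lintegral_congr fun z => ?_
    by_cases hz : y < z
    · rw [indicator_of_notMem (by simpa using hz), tentKernel, if_pos hz,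
        ENNReal.ofReal_of_nonpos (by linarith), mul_zero]
    · rw [indicator_of_mem (by simpa using hz), tentKernel, if_neg hz]

lemma measurable_qfun {η : ℝ → ℝ} (hη : Measurable η) (y : ℝ) : Measurable (qfun η y) := by
  simp_rw [funext fun x => qfun_eq_lintegral hη y x]
  exact Measurable.lintegral_prod_right'
    (f := fun p : ℝ × ℝ => qIntegrand η p.2 * tentKernel y p.1 p.2)
    (((measurable_qIntegrand hη).comp measurable_snd).mul (measurable_tentKernel y))

lemma continuous_tentKernel (y z : ℝ) : Continuous fun x => tentKernel y x z := by
  unfold tentKernel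
  split_ifs
  · exact ENNReal.continuous_ofReal.comp (by fun_prop)
  · exact ENNReal.continuous_ofReal.comp (by fun_prop)

lemma qfun_le_liminf {η : ℝ → ℝ} (hη : Measurable η) (y : ℝ) {x : ℝ} {u : ℕ → ℝ}
    (hu : Tendsto u atTop (𝓝 x)) :
    qfun η y x ≤ liminf (fun n => qfun η y (u n)) atTop := by
  simp_rw [qfun_eq_lintegral hη]
  refine le_trans (lintegral_mono fun z => ?_) (lintegral_liminf_le fun n =>
    (measurable_qIntegrand hη).mul ((measurable_tentKernel y).comp measurable_prodMk_left))
  by_cases h0 : tentKernel y x z = 0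
  · simp [h0]
  · exact (ENNReal.Tendsto.const_mul (((continuous_tentKernel y z).tendsto x).comp hu)
      (Or.inl h0)).liminf_eq.ge

lemma Gfun_le_liminf {η : ℝ → ℝ} (hη : Measurable η) (μ : Measure ℝ) (y : ℝ) {a : ℝ}
    {u : ℕ → ℝ} (hu : Tendsto u atTop (𝓝 a)) :
    Gfun η μ y a ≤ liminf (fun n => Gfun η μ y (u n)) atTop := by
  refine le_trans (lintegral_mono fun x => qfun_le_liminf hη y (u := fun n => y + u n * x) ?_)
    (lintegral_liminf_le fun n => (measurable_qfun hη y).comp (by fun_prop))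
  exact tendsto_const_nhds.add (hu.mul_const x)

lemma Gfun_zero (η : ℝ → ℝ) (μ : Measure ℝ) (y : ℝ) : Gfun η μ y 0 = 0 := by
  simp [Gfun, qfun]

lemma tentKernel_convex (y z : ℝ) {s t : ℝ} (hs : 0 ≤ s) (ht : 0 ≤ t) (hst : s + t = 1)
    (x₁ x₂ : ℝ) :
    tentKernel y (s * x₁ + t * x₂) z
      ≤ ENNReal.ofReal s * tentKernel y x₁ z + ENNReal.ofReal t * tentKernel y x₂ z := by
  unfold tentKernel
  split_ifs <;>
    rw [← ENNReal.ofReal_mul hs, ← ENNReal.ofReal_mul ht] <;>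
    refine le_trans (ENNReal.ofReal_le_ofReal (le_of_eq ?_)) ENNReal.ofReal_add_le
  · linear_combination z * hst
  · linear_combination (-z) * hst

lemma qfun_convex {η : ℝ → ℝ} (hη : Measurable η) (y : ℝ) {s t : ℝ} (hs : 0 ≤ s) (ht : 0 ≤ t)
    (hst : s + t = 1) (x₁ x₂ : ℝ) :
    qfun η y (s * x₁ + t * x₂)
      ≤ ENNReal.ofReal s * qfun η y x₁ + ENNReal.ofReal t * qfun η y x₂ := by
  have hm : ∀ x, Measurable fun z => qIntegrand η z * tentKernel y x z := fun x =>
    (measurable_qIntegrand hη).mul ((measurable_tentKernel y).comp measurable_prodMk_left)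
  simp_rw [qfun_eq_lintegral hη]
  rw [← lintegral_const_mul _ (hm x₁), ← lintegral_const_mul _ (hm x₂),
    ← lintegral_add_left ((hm x₁).const_mul _)]
  refine lintegral_mono fun z => ?_
  calc qIntegrand η z * tentKernel y (s * x₁ + t * x₂) z
      ≤ qIntegrand η z * (ENNReal.ofReal s * tentKernel y x₁ z
          + ENNReal.ofReal t * tentKernel y x₂ z) := by
        gcongr
        exact tentKernel_convex y z hs ht hst x₁ x₂
    _ = _ := by ring

lemma Gfun_convex {η : ℝ → ℝ} (hη : Measurable η) (μ : Measure ℝ) (y : ℝ) {s t : ℝ}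
    (hs : 0 ≤ s) (ht : 0 ≤ t) (hst : s + t = 1) (a₁ a₂ : ℝ) :
    Gfun η μ y (s * a₁ + t * a₂)
      ≤ ENNReal.ofReal s * Gfun η μ y a₁ + ENNReal.ofReal t * Gfun η μ y a₂ := by
  have hm : ∀ a : ℝ, Measurable fun x => qfun η y (y + a * x) := fun a =>
    (measurable_qfun hη y).comp (by fun_prop)
  unfold Gfun
  rw [← lintegral_const_mul _ (hm a₁), ← lintegral_const_mul _ (hm a₂),
    ← lintegral_add_left ((hm a₁).const_mul _)]
  refine lintegral_mono fun x => ?_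
  have h : y + (s * a₁ + t * a₂) * x = s * (y + a₁ * x) + t * (y + a₂ * x) := by
    linear_combination (-y) * hst
  simp only [h]
  exact qfun_convex hη y hs ht hst _ _

/-- Below a finite value of the convex function `Gfun η μ y`, strict sublevel sets extend to the
right. -/
lemma exists_gt_Gfun_le {η : ℝ → ℝ} (hη : Measurable η) (μ : Measure ℝ) (y : ℝ) {a b : ℝ}
    {K : ℝ≥0∞} (hab : a < b) (ha : Gfun η μ y a < K) (hb : Gfun η μ y b ≠ ⊤) :
    ∃ a' > a, Gfun η μ y a' ≤ K := by
  have hlim : Tendsto (fun t : ℝ => Gfun η μ y a + ENNReal.ofReal t * Gfun η μ y b) (𝓝[>] 0)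
      (𝓝 (Gfun η μ y a + ENNReal.ofReal 0 * Gfun η μ y b)) := by
    refine Tendsto.mono_left ?_ nhdsWithin_le_nhds
    exact tendsto_const_nhds.add
      (ENNReal.Tendsto.mul_const (ENNReal.continuous_ofReal.tendsto 0) (Or.inr hb))
  rw [ENNReal.ofReal_zero, zero_mul, add_zero] at hlim
  obtain ⟨t, htK, ht0, ht1⟩ :=
    ((hlim.eventually (gt_mem_nhds ha)).and (Ioo_mem_nhdsGT (zero_lt_one' ℝ))).exists
  refine ⟨(1 - t) * a + t * b, by nlinarith, ?_⟩
  refine (Gfun_convex hη μ y (by linarith) ht0.le (by ring) a b).trans (le_trans ?_ htK.le)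
  gcongr
  exact mul_le_of_le_one_left zero_le (ENNReal.ofReal_le_one.2 (by linarith))

lemma qfun_eq_top {η : ℝ → ℝ} (hη : Measurable η) {l y x : ℝ} (hη0 : ∀ z ≤ l, η z = 0)
    (hy : l < y) (hx : x < l) : qfun η y x = ⊤ := by
  rw [qfun_eq_lintegral hη, eq_top_iff]
  calc (⊤ : ℝ≥0∞) = ∫⁻ _ in Ioo x l, ⊤ := by
        rw [setLIntegral_const, Real.volume_Ioo, ENNReal.top_mul]
        simpa using hx
    _ ≤ ∫⁻ z in Ioo x l, qIntegrand η z * tentKernel y x z := by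
        refine setLIntegral_mono' measurableSet_Ioo fun z hz => ?_
        rw [qIntegrand_eq_top (hη0 z hz.2.le), ENNReal.top_mul]
        rw [tentKernel, if_neg (by linarith [hz.2])]
        simpa using hz.1
    _ ≤ _ := setLIntegral_le_lintegral _ _

lemma Gfun_eq_top {η : ℝ → ℝ} (hη : Measurable η) {l y a c : ℝ} {μ : Measure ℝ}
    (hη0 : ∀ z ≤ l, η z = 0) (hy : l < y) (ha : 0 < a) (hac : y + a * c < l)
    (hc_inf : ∀ ε > (0 : ℝ), 0 < μ (Iio (c + ε))) : Gfun η μ y a = ⊤ := by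
  have hε : 0 < (l - y - a * c) / a := div_pos (by linarith) ha
  rw [Gfun, eq_top_iff]
  calc (⊤ : ℝ≥0∞) = ∫⁻ _ in Iio (c + (l - y - a * c) / a), ⊤ ∂μ := by
        rw [setLIntegral_const, ENNReal.top_mul (hc_inf _ hε).ne']
    _ ≤ ∫⁻ x in Iio (c + (l - y - a * c) / a), qfun η y (y + a * x) ∂μ := by
        refine setLIntegral_mono' measurableSet_Iio fun x hx => ?_
        rw [qfun_eq_top hη hη0 hy]
        have h := mul_lt_mul_of_pos_left (mem_Iio.1 hx) ha
        rw [mul_add, mul_div_cancel₀ _ ha.ne'] at h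
        linarith
    _ ≤ _ := setLIntegral_le_lintegral _ _

lemma setLIntegral_qIntegrand_lt_top {η : ℝ → ℝ} {l m M : ℝ} (hηne : ∀ x ∈ Ioi l, η x ≠ 0)
    (hηloc : LocallyIntegrableOn (fun z => 1 / (η z) ^ 2) (Ioi l) volume) (hm : l < m) :
    ∫⁻ z in Icc m M, qIntegrand η z < ⊤ := by
  have hsub : Icc m M ⊆ Ioi l := fun z hz => hm.trans_le hz.1
  have hint := ((hηloc.integrableOn_compact_subset hsub isCompact_Icc).const_mul 2).lintegral_lt_top
  refine lt_of_eq_of_lt (setLIntegral_congr_fun measurableSet_Icc fun z hz => ?_) hint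
  have := hηne z (hsub hz)
  have h2 : 0 < (η z) ^ 2 := by positivity
  simp only [qIntegrand]
  rw [mul_one_div, ENNReal.ofReal_div_of_pos h2]
  simp

lemma tentKernel_le_of_nonneg {y y₀ b x : ℝ} (m : ℝ) (hb : 0 ≤ b) (hx : 0 ≤ x) (hm : m ≤ y)
    (z : ℝ) :
    tentKernel y (y + b * x) z ≤ tentKernel y₀ (y₀ + (b + |y - y₀|) * x) z
      + (Icc m (max y y₀ + b)).indicator (fun _ => ENNReal.ofReal (b * |x|)) z := by
  have hbx := mul_nonneg hb hx
  rw [abs_of_nonneg hx]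
  by_cases hz : y < z
  · rw [tentKernel, if_pos hz]
    by_cases hzM : z ≤ max y y₀ + b
    · rw [indicator_of_mem (mem_Icc.2 ⟨hm.trans hz.le, hzM⟩)]
      exact (ENNReal.ofReal_le_ofReal (by linarith)).trans le_add_self
    · have h₀ : y₀ < z := by linarith [le_max_right y y₀]
      rw [tentKernel, if_pos h₀]
      refine le_trans ?_ le_self_add
      by_cases hpos : y + b * x - z ≤ 0
      · simp [ENNReal.ofReal_of_nonpos hpos]
      · refine ENNReal.ofReal_le_ofReal ?_
        have hx1 : 1 ≤ x := by
          by_contra! hlt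
          nlinarith [le_max_left y y₀]
        nlinarith [le_abs_self (y - y₀), abs_nonneg (y - y₀)]
  · rw [tentKernel, if_neg hz, ENNReal.ofReal_of_nonpos (by linarith)]
    exact zero_le

lemma tentKernel_le_of_neg {y b c x m M : ℝ} (hb : 0 ≤ b) (hx : x < 0) (hcx : c ≤ x)
    (hm : m ≤ y + b * c) (hM : y ≤ M) (z : ℝ) :
    tentKernel y (y + b * x) z
      ≤ (Icc m M).indicator (fun _ => ENNReal.ofReal (b * |x|)) z := by
  have hbx : b * x ≤ 0 := mul_nonpos_of_nonneg_of_nonpos hb hx.le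
  have hbc : b * c ≤ b * x := mul_le_mul_of_nonneg_left hcx hb
  rw [abs_of_neg hx, tentKernel]
  split_ifs with hz
  · rw [ENNReal.ofReal_of_nonpos (by linarith)]
    exact zero_le
  · by_cases hzm : m ≤ z
    · rw [indicator_of_mem (mem_Icc.2 ⟨hzm, by linarith⟩)]
      exact ENNReal.ofReal_le_ofReal (by linarith)
    · rw [ENNReal.ofReal_of_nonpos (by linarith)]
      exact zero_le

lemma Gfun_lt_top {η : ℝ → ℝ} (hη : Measurable η) {l y y₀ b c : ℝ} {μ : Measure ℝ}
    (hηne : ∀ x ∈ Ioi l, η x ≠ 0)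
    (hηloc : LocallyIntegrableOn (fun z => 1 / (η z) ^ 2) (Ioi l) volume)
    (hμint : Integrable (fun x => x) μ) (hc_null : μ (Iio c) = 0) (hc : c < 0) (hb : 0 < b)
    (hbc : l < y + b * c)
    (hA2 : ∀ a : ℝ, 0 < a → ∫⁻ x in Ici (0 : ℝ), qfun η y₀ (y₀ + a * x) ∂μ < ⊤) :
    Gfun η μ y b < ⊤ := by
  set a := b + |y - y₀| with ha
  set m := y + b * c with hm
  set M := max y y₀ + b with hM
  set C := ∫⁻ z in Icc m M, qIntegrand η z with hC
  have hCtop : C < ⊤ := setLIntegral_qIntegrand_lt_top hηne hηloc hbc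
  have hmy : m ≤ y := by nlinarith
  have hyM : y ≤ M := by linarith [le_max_left y y₀]
  have hf := measurable_qIntegrand hη
  have hk : ∀ x, Measurable fun z => qIntegrand η z * tentKernel y₀ x z := fun x =>
    hf.mul ((measurable_tentKernel y₀).comp measurable_prodMk_left)
  have hind : ∀ r : ℝ≥0∞, ∫⁻ z, qIntegrand η z * (Icc m M).indicator (fun _ => r) z = C * r := by
    intro r
    rw [hC, ← lintegral_mul_const _ hf, ← lintegral_indicator measurableSet_Icc]
    refine lintegral_congr fun z => ?_
    by_cases hz : z ∈ Icc m M <;> simp [hz]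
  have hbound : ∀ x, c ≤ x → qfun η y (y + b * x)
      ≤ (Ici (0 : ℝ)).indicator (fun x => qfun η y₀ (y₀ + a * x)) x
        + C * ENNReal.ofReal (b * |x|) := by
    intro x hcx
    rcases lt_or_ge x 0 with hx | hx
    · rw [indicator_of_notMem (by simpa using hx), zero_add, qfun_eq_lintegral hη, ← hind]
      refine lintegral_mono fun z => ?_
      gcongr
      exact tentKernel_le_of_neg hb.le hx hcx le_rfl hyM z
    · rw [indicator_of_mem (mem_Ici.2 hx), qfun_eq_lintegral hη, qfun_eq_lintegral hη, ← hind,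
        ← lintegral_add_left (hk _)]
      refine lintegral_mono fun z => ?_
      simp only [← mul_add]
      gcongr
      exact tentKernel_le_of_nonneg m hb.le hx hmy z
  have hae : ∀ᵐ x ∂μ, c ≤ x := by
    rw [ae_iff]
    simpa [Iio] using hc_null
  have hmom : ∫⁻ x, ENNReal.ofReal (b * |x|) ∂μ < ⊤ :=
    (hμint.abs.const_mul b).lintegral_lt_top
  calc Gfun η μ y b
      ≤ ∫⁻ x, ((Ici (0 : ℝ)).indicator (fun x => qfun η y₀ (y₀ + a * x)) x
          + C * ENNReal.ofReal (b * |x|)) ∂μ :=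
        lintegral_mono_ae (hae.mono hbound)
    _ = ∫⁻ x in Ici (0 : ℝ), qfun η y₀ (y₀ + a * x) ∂μ
          + C * ∫⁻ x, ENNReal.ofReal (b * |x|) ∂μ := by
        rw [lintegral_add_right _ (by fun_prop), lintegral_indicator measurableSet_Ici,
          lintegral_const_mul _ (by fun_prop)]
    _ < ⊤ := ENNReal.add_lt_top.2
        ⟨hA2 a (by positivity), ENNReal.mul_lt_top hCtop hmom⟩

lemma exists_pos_le_setLIntegral_Ioc {f : ℝ → ℝ≥0∞} (hf : Measurable f) (hpos : ∀ z, 0 < f z)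
    {K : Set ℝ} (hK : IsCompact K) {δ : ℝ} (hδ : 0 < δ) :
    ∃ ε > (0 : ℝ≥0∞), ∀ y ∈ K, ε ≤ ∫⁻ z in Ioc (y - δ) y, f z := by
  refine hK.induction_on (p := fun s => ∃ ε > (0 : ℝ≥0∞), ∀ y ∈ s,
    ε ≤ ∫⁻ z in Ioc (y - δ) y, f z) ⟨1, one_pos, by simp⟩ ?_ ?_ ?_
  · rintro s t hst ⟨ε, hε, h⟩
    exact ⟨ε, hε, fun y hy => h y (hst hy)⟩
  · rintro s t ⟨ε₁, hε₁, h₁⟩ ⟨ε₂, hε₂, h₂⟩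
    refine ⟨min ε₁ ε₂, lt_min hε₁ hε₂, ?_⟩
    rintro y (hy | hy)
    · exact (min_le_left _ _).trans (h₁ y hy)
    · exact (min_le_right _ _).trans (h₂ y hy)
  · intro y₀ _
    refine ⟨Ioo (y₀ - δ / 4) (y₀ + δ / 4),
      mem_nhdsWithin_of_mem_nhds (Ioo_mem_nhds (by linarith) (by linarith)),
      ∫⁻ z in Ioc (y₀ - δ / 2) (y₀ - δ / 4), f z, ?_, fun y hy => ?_⟩
    · rw [gt_iff_lt, setLIntegral_pos_iff hf]
      have : Function.support f = univ := by
        ext z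
        simp [(hpos z).ne']
      rw [this, univ_inter, Real.volume_Ioc]
      simp only [ENNReal.ofReal_pos]
      linarith
    · refine lintegral_mono_set fun z hz => ?_
      constructor <;> linarith [hz.1, hz.2, hy.1, hy.2]

lemma le_qfun_of_le_sub {η : ℝ → ℝ} (hη : Measurable η) {y x δ : ℝ} (hx : x ≤ y - 2 * δ) :
    ENNReal.ofReal δ * ∫⁻ z in Ioc (y - δ) y, qIntegrand η z ≤ qfun η y x := by
  rw [qfun_eq_lintegral hη, ← lintegral_const_mul _ (measurable_qIntegrand hη)]
  refine le_trans (setLIntegral_mono' measurableSet_Ioc fun z hz => ?_)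
    (setLIntegral_le_lintegral (Ioc (y - δ) y) _)
  rw [mul_comm, tentKernel, if_neg (not_lt.2 hz.2)]
  gcongr
  linarith [hz.1]

lemma exists_pos_le_Gfun {η : ℝ → ℝ} (hη : Measurable η) {l c c₁ d₁ : ℝ} {μ : Measure ℝ}
    (hl : l < c₁) (hc : c < 0) (hc_inf : ∀ ε > (0 : ℝ), 0 < μ (Iio (c + ε))) :
    ∃ ε > (0 : ℝ≥0∞), ∀ y ∈ Icc c₁ d₁, ε ≤ Gfun η μ y ((l - y) / c) := by
  obtain ⟨ε, hε, h⟩ := exists_pos_le_setLIntegral_Ioc (measurable_qIntegrand hη)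
    (qIntegrand_pos η) (isCompact_Icc (a := c₁) (b := d₁)) (δ := (c₁ - l) / 4) (by linarith)
  refine ⟨ENNReal.ofReal ((c₁ - l) / 4) * ε * μ (Iio (c + -c / 2)), ?_, fun y hy => ?_⟩
  · have h1 : 0 < ENNReal.ofReal ((c₁ - l) / 4) := by
      rw [ENNReal.ofReal_pos]
      linarith
    exact ENNReal.mul_pos (ENNReal.mul_pos h1.ne' hε.ne').ne' (hc_inf _ (by linarith)).ne'
  · rw [← setLIntegral_const]
    refine le_trans (setLIntegral_mono' measurableSet_Iio fun x hx => ?_)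
      (setLIntegral_le_lintegral (Iio (c + -c / 2)) _)
    refine le_trans ?_ (le_qfun_of_le_sub (δ := (c₁ - l) / 4) hη ?_)
    · gcongr
      exact h y hy
    · have ha : 0 < (l - y) / c := div_pos_of_neg_of_neg (by linarith [hy.1]) hc
      have hx' : x ≤ c / 2 := by linarith [mem_Iio.1 hx]
      have h2 := mul_le_mul_of_nonneg_left hx' ha.le
      have h3 : (l - y) / c * (c / 2) = (l - y) / 2 := by
        rw [← mul_div_assoc, div_mul_cancel₀ _ hc.ne]
      linarith [hy.1]

/-- A centered probability measure other than `δ₀` charges the negative half-line. -/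
lemma inf_support_neg {μ : Measure ℝ} [IsProbabilityMeasure μ]
    (hμint : Integrable (fun x => x) μ) (hμcen : ∫ x, x ∂μ = 0) (hμne : μ ≠ Measure.dirac 0)
    {c : ℝ} (hc_null : μ (Iio c) = 0) : c < 0 := by
  by_contra! hc
  have hae : ∀ᵐ x ∂μ, (0 : ℝ) ≤ x := by
    rw [ae_iff]
    exact measure_mono_null (fun x hx => (not_le.1 hx).trans_le hc) hc_null
  have h0 : (fun x => x) =ᵐ[μ] (0 : ℝ → ℝ) := (integral_eq_zero_iff_of_nonneg_ae hae hμint).1 hμcen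
  refine hμne ?_
  calc μ = μ.map (fun x => x) := Measure.map_id'.symm
    _ = μ.map (fun _ => (0 : ℝ)) := Measure.map_congr h0
    _ = Measure.dirac 0 := by simp [Measure.map_const]

/-- **Statement (Eq)** (Case 2: `I = (l,∞)`, condition (A2)).
With `a_N(y) = sup {a ≥ 0 : G_y(a) ≤ 1/N}`, for every compact subinterval
`J = [c₁, d₁] ⊂ I` there exists `N₁ ∈ ℕ` such that for all `N ≥ N₁` and all `y ∈ J` one has
`G_y(a_N(y)) = 1/N`.  Here `c = inf supp μ`. -/
theorem scale_factor_eq_on_compacts_case2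
    (l : ℝ) (η : ℝ → ℝ) (hηmeas : Measurable η)
    (hηne : ∀ x ∈ Set.Ioi l, η x ≠ 0) (hηzero : ∀ x ∉ Set.Ioi l, η x = 0)
    (hηloc : LocallyIntegrableOn (fun z => 1 / (η z) ^ 2) (Set.Ioi l) volume)
    (μ : Measure ℝ) [IsProbabilityMeasure μ]
    (hμint : Integrable (fun x => x) μ) (hμcen : ∫ x, x ∂μ = 0)
    (hμne : μ ≠ Measure.dirac 0)
    (c : ℝ) (hc_null : μ (Set.Iio c) = 0) (hc_inf : ∀ ε > (0 : ℝ), 0 < μ (Set.Iio (c + ε)))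
    (hA2 : ∃ y ∈ Set.Ioi l, ∀ a : ℝ, 0 < a →
      ∫⁻ x in Set.Ici (0 : ℝ), qfun η y (y + a * x) ∂μ < ⊤) :
    ∀ c₁ d₁ : ℝ, l < c₁ →
      ∃ N₁ : ℕ, ∀ N : ℕ, N₁ ≤ N → ∀ y ∈ Set.Icc c₁ d₁,
        Gfun η μ y (sSup {a : ℝ | 0 ≤ a ∧ Gfun η μ y a ≤ 1 / (N : ℝ≥0∞)})
          = 1 / (N : ℝ≥0∞) := by
  intro c₁ d₁ hl
  have hc : c < 0 := inf_support_neg hμint hμcen hμne hc_null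
  have hη0 : ∀ z ≤ l, η z = 0 := fun z hz => hηzero z (by simpa using hz)
  obtain ⟨y₀, -, hA2⟩ := hA2
  obtain ⟨ε, hε, hlow⟩ := exists_pos_le_Gfun (d₁ := d₁) hηmeas hl hc hc_inf
  obtain ⟨n, hn⟩ := ENNReal.exists_inv_nat_lt hε.ne'
  refine ⟨n + 1, fun N hN y hy => ?_⟩
  have hN0 : (N : ℝ≥0∞) ≠ 0 := by
    simp only [ne_eq, Nat.cast_eq_zero]
    omega
  have hK : 1 / (N : ℝ≥0∞) ≤ ε := by
    rw [one_div]
    refine le_trans (ENNReal.inv_le_inv.2 ?_) hn.le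
    exact_mod_cast (Nat.le_succ n).trans hN
  have hKtop : 1 / (N : ℝ≥0∞) ≠ ⊤ := by simpa using hN0
  generalize 1 / (N : ℝ≥0∞) = K at hK hKtop
  have hly : l < y := hl.trans_le hy.1
  set A := (l - y) / c with hA
  have hApos : 0 < A := div_pos_of_neg_of_neg (by linarith) hc
  have hAc : A * c = l - y := div_mul_cancel₀ _ hc.ne
  set S := {a : ℝ | 0 ≤ a ∧ Gfun η μ y a ≤ K} with hS
  have hSne : S.Nonempty := ⟨0, le_rfl, by simp [Gfun_zero]⟩
  have hSA : ∀ a ∈ S, a ≤ A := by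
    intro a ha
    by_contra! hlt
    refine hKtop (top_le_iff.1 (le_trans (le_of_eq ?_) ha.2))
    refine (Gfun_eq_top hηmeas hη0 hly (hApos.trans hlt) ?_ hc_inf).symm
    nlinarith
  have hSbdd : BddAbove S := ⟨A, hSA⟩
  have hs0 : 0 ≤ sSup S := le_csSup hSbdd ⟨le_rfl, by simp [Gfun_zero]⟩
  obtain ⟨u, -, hu, huS⟩ := exists_seq_tendsto_sSup hSne hSbdd
  have hle : Gfun η μ y (sSup S) ≤ K := by
    refine (Gfun_le_liminf hηmeas μ y hu).trans ?_
    calc liminf (fun n => Gfun η μ y (u n)) atTop ≤ liminf (fun _ : ℕ => K) atTop :=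
          liminf_le_liminf (Eventually.of_forall fun n => (huS n).2)
      _ = K := liminf_const K
  refine hle.antisymm (not_lt.1 fun hlt => ?_)
  rcases (csSup_le hSne hSA).lt_or_eq with h | h
  · obtain ⟨b, hsb, hbA⟩ := exists_between h
    have hb : Gfun η μ y b < ⊤ := Gfun_lt_top hηmeas hηne hηloc hμint hc_null hc
      (hs0.trans_lt hsb) (by nlinarith) hA2
    obtain ⟨a, hsa, haK⟩ := exists_gt_Gfun_le hηmeas μ y hsb hlt hb.ne
    exact not_le.2 hsa (le_csSup hSbdd ⟨hs0.trans hsa.le, haK⟩)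
  · rw [h] at hlt
    exact absurd (hK.trans (hlow y hy)) (not_le.2 hlt)
end
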